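/- arXiv:1407.8222 — 2 statements merged into one kernel-verified Lean document; each statement's English description precedes it below -/
import Mathlib

section
/- Let f : ℕ → ℕ be a binomial multisum. Then f is a finite sum of balanced positive multisums; conversely, every finite sum of balanced positive multisums is a binomial multisum. (In the paper's notation, 𝓑 = 𝓑′.) -/
/-- Modified binomial coefficient: `C(a,b) = a!/((a-b)!·b!)` if `0 ≤ b ≤ a`,
`C(-1,0) = 1`, and `0` otherwise. -/
def mbinom (a b : ℤ) : ℕ :=
  if 0 ≤ b ∧ b ≤ a then a.toNat.choose b.toNat
  else if a = -1 ∧ b = 0 then 1 else 0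

/-- The general term of a binomial multisum, indexed by `v ∈ ℤ^d`. -/
def multisumTerm {r d : ℕ} (A B : Fin r → Fin d → ℤ) (a' a'' b' b'' : Fin r → ℤ)
    (n : ℕ) (v : Fin d → ℤ) : ℕ :=
  ∏ i, mbinom ((∑ j, A i j * v j) + a' i * (n : ℤ) + a'' i)
              ((∑ j, B i j * v j) + b' i * (n : ℤ) + b'' i)

/-- `f : ℕ → ℕ` is a binomial multisum: for every `n` only finitely many `v ∈ ℤ^d`
contribute, and `f n` is the (finite) sum of the products of modified binomial
coefficients of integer-coefficient affine functions of `(v, n)`. -/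
def IsBinomialMultisum (f : ℕ → ℕ) : Prop :=
  ∃ (r d : ℕ) (A B : Fin r → Fin d → ℤ) (a' a'' b' b'' : Fin r → ℤ),
    (∀ n : ℕ, (Function.support (multisumTerm A B a' a'' b' b'' n)).Finite) ∧
    ∀ n : ℕ, f n = ∑ᶠ v : Fin d → ℤ, multisumTerm A B a' a'' b' b'' n v

/-- The term of a balanced positive multisum: `α_i!/(β_i!·γ_i!)` where `α_i = β_i + γ_i`,
restricted to those `v` with `β_i(v,n), γ_i(v,n) ≥ 0` for all `i`. -/
def balancedTerm {r d : ℕ} (B C : Fin r → Fin d → ℤ) (b' b'' c' c'' : Fin r → ℤ)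
    (n : ℕ) (v : Fin d → ℤ) : ℕ :=
  if ∀ i, 0 ≤ (∑ j, B i j * v j) + b' i * (n : ℤ) + b'' i ∧
          0 ≤ (∑ j, C i j * v j) + c' i * (n : ℤ) + c'' i then
    ∏ i, Nat.choose
      (((∑ j, B i j * v j) + b' i * (n : ℤ) + b'' i) +
        ((∑ j, C i j * v j) + c' i * (n : ℤ) + c'' i)).toNat
      ((∑ j, B i j * v j) + b' i * (n : ℤ) + b'' i).toNat
  else 0

/-- `g : ℕ → ℕ` is a balanced positive multisum:
`g(n) = ∑_v ∏_i α_i(v,n)!/(β_i(v,n)!·γ_i(v,n)!)` where `α_i, β_i, γ_i` are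
integer-coefficient affine functions with `α_i = β_i + γ_i`, the sum ranging over the
`v ∈ ℤ^d` with all `β_i(v,n), γ_i(v,n) ≥ 0`, only finitely many of which contribute. -/
def IsBalancedPositiveMultisum (g : ℕ → ℕ) : Prop :=
  ∃ (r d : ℕ) (B C : Fin r → Fin d → ℤ) (b' b'' c' c'' : Fin r → ℤ),
    (∀ n : ℕ, (Function.support (balancedTerm B C b' b'' c' c'' n)).Finite) ∧
    ∀ n : ℕ, g n = ∑ᶠ v : Fin d → ℤ, balancedTerm B C b' b'' c' c'' n v

/-- A map between additive commutative groups that preserves affine combinations with integer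
coefficients, expressed by its functional equation. -/
def IsIntAffine {M N : Type} [AddCommGroup M] [AddCommGroup N] (f : M → N) : Prop :=
  ∀ u v, f (u + v) + f 0 = f u + f v

/-- The finite products of functions `u ↦ φ (a u) (b u)` with `a` and `b` integer affine. -/
def affineProducts (φ : ℤ → ℤ → ℕ) (M : Type) [AddCommGroup M] : Submonoid (M → ℕ) :=
  Submonoid.closure
    {T | ∃ a b : M → ℤ, IsIntAffine a ∧ IsIntAffine b ∧ T = fun u => φ (a u) (b u)}

/-- The factor of a balanced term: `(x + y)! / (x! y!)` if `x, y ≥ 0`, and `0` otherwise. -/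
def balancedFactor (x y : ℤ) : ℕ :=
  if 0 ≤ x ∧ 0 ≤ y then (x + y).toNat.choose x.toNat else 0

section Affine

variable {M N : Type} [AddCommGroup M] [AddCommGroup N]

theorem IsIntAffine.comp {f : N → ℤ} {h : M → N} (hf : IsIntAffine f) (hh : IsIntAffine h) :
    IsIntAffine fun u => f (h u) := by
  intro u v
  have h₁ := hf (h (u + v)) (h 0)
  have h₂ := hf (h u) (h v)
  rw [hh u v] at h₁
  exact h₁.symm.trans h₂

/-- An integer affine function on `ℤ^d × ℤ` in coordinates. -/
theorem IsIntAffine.exists_coeff {d : ℕ} {f : (Fin d → ℤ) × ℤ → ℤ} (hf : IsIntAffine f) :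
    ∃ (A : Fin d → ℤ) (a' a'' : ℤ), ∀ v n, f (v, n) = (∑ j, A j * v j) + a' * n + a'' := by
  let g : (Fin d → ℤ) × ℤ →+ ℤ := AddMonoidHom.mk' (fun u => f u - f 0) fun u v => by
    have := hf u v
    linarith
  refine ⟨fun j => g (Pi.single j 1, 0), g (0, 1), f 0, fun v n => ?_⟩
  have hg : f (v, n) = g (v, n) + f 0 := by simp [g]
  have hsplit : g (v, n) = g (v, 0) + g (0, n) := by
    rw [← map_add]
    simp
  have hleft : g (v, 0) = ∑ j, g (Pi.single j 1, 0) * v j := by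
    have := ((g.comp (AddMonoidHom.inl _ _)).toIntLinearMap).pi_apply_eq_sum_univ v
    simp only [AddMonoidHom.coe_toIntLinearMap, AddMonoidHom.comp_apply,
      AddMonoidHom.inl_apply, smul_eq_mul] at this
    rw [this]
    refine Finset.sum_congr rfl fun j _ => ?_
    rw [mul_comm]
    congr 3
    ext i
    simp [Pi.single_apply, eq_comm]
  have hright : g (0, n) = g (0, 1) * n := by
    have := map_zsmul g n ((0 : Fin d → ℤ), (1 : ℤ))
    simpa [mul_comm] using this
  rw [hg, hsplit, hleft, hright]

theorem isIntAffine_of_coeff {d : ℕ} (A : Fin d → ℤ) (a' a'' : ℤ) :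
    IsIntAffine fun u : (Fin d → ℤ) × ℤ => (∑ j, A j * u.1 j) + a' * u.2 + a'' := by
  intro u v
  simp [mul_add, Finset.sum_add_distrib]
  ring

end Affine

section AffineProducts

variable {φ : ℤ → ℤ → ℕ} {M N : Type} [AddCommGroup M] [AddCommGroup N]

theorem mem_affineProducts {a b : M → ℤ} (ha : IsIntAffine a) (hb : IsIntAffine b) :
    (fun u => φ (a u) (b u)) ∈ affineProducts φ M :=
  Submonoid.subset_closure ⟨a, b, ha, hb, rfl⟩

theorem comp_mem_affineProducts {T : N → ℕ} (hT : T ∈ affineProducts φ N) {h : M → N}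
    (hh : IsIntAffine h) : (fun u => T (h u)) ∈ affineProducts φ M := by
  induction hT using Submonoid.closure_induction with
  | mem T hT =>
    obtain ⟨a, b, ha, hb, rfl⟩ := hT
    exact mem_affineProducts (ha.comp hh) (hb.comp hh)
  | one => exact one_mem _
  | mul S T _ _ hS hT => exact mul_mem hS hT

theorem prod_mem_affineProducts {ι : Type} (s : Finset ι) {T : ι → M → ℕ}
    (hT : ∀ i ∈ s, T i ∈ affineProducts φ M) :
    (fun u => ∏ i ∈ s, T i u) ∈ affineProducts φ M := by
  have := prod_mem hT
  rwa [Finset.prod_fn] at this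

theorem mul_mem_affineProducts {S T : M → ℕ} (hS : S ∈ affineProducts φ M)
    (hT : T ∈ affineProducts φ M) : (fun u => S u * T u) ∈ affineProducts φ M :=
  mul_mem hS hT

/-- If `φ 0 0 = 1`, affine products can be homogenized. -/
theorem exists_homogenization (hφ : φ 0 0 = 1) {T : M → ℕ} (hT : T ∈ affineProducts φ M) :
    ∃ S ∈ affineProducts φ (M × ℤ), (∀ u, S (u, 1) = T u) ∧ S (0, 0) = 1 := by
  induction hT using Submonoid.closure_induction with
  | mem T hT =>
    obtain ⟨a, b, ha, hb, rfl⟩ := hT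
    have key {f : M → ℤ} (hf : IsIntAffine f) :
        IsIntAffine fun u : M × ℤ => f u.1 - f 0 + f 0 * u.2 := by
      intro u v
      have := hf u.1 v.1
      simp only [Prod.fst_add, Prod.snd_add, Prod.fst_zero, Prod.snd_zero]
      linarith
    exact ⟨_, mem_affineProducts (key ha) (key hb), by simp, by simp [hφ]⟩
  | one => exact ⟨1, one_mem _, by simp, by simp⟩
  | mul T₁ T₂ _ _ h₁ h₂ =>
    obtain ⟨S₁, hS₁, h₁, h₁'⟩ := h₁
    obtain ⟨S₂, hS₂, h₂, h₂'⟩ := h₂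
    exact ⟨S₁ * S₂, mul_mem hS₁ hS₂, by simp [h₁, h₂], by simp [h₁', h₂']⟩

theorem mem_affineProducts_iff_exists_coeff {d : ℕ} {T : (Fin d → ℤ) × ℤ → ℕ} :
    T ∈ affineProducts φ ((Fin d → ℤ) × ℤ) ↔
      ∃ (r : ℕ) (A B : Fin r → Fin d → ℤ) (a' a'' b' b'' : Fin r → ℤ),
        ∀ v n, T (v, n) = ∏ i, φ ((∑ j, A i j * v j) + a' i * n + a'' i)
          ((∑ j, B i j * v j) + b' i * n + b'' i) := by
  constructor
  · intro hT
    obtain ⟨l, hl, rfl⟩ := Submonoid.exists_list_of_mem_closure hT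
    have hl' (i : Fin l.length) := hl (l.get i) (l.get_mem i)
    choose a b ha hb hab using hl'
    choose A a' a'' hA using fun i => (ha i).exists_coeff
    choose B b' b'' hB using fun i => (hb i).exists_coeff
    refine ⟨l.length, A, B, a', a'', b', b'', fun v n => ?_⟩
    have hl_prod : l.prod = ∏ i, l.get i := by rw [← List.prod_ofFn, List.ofFn_get]
    simp only [hl_prod, Finset.prod_apply, hab, hA, hB]
  · rintro ⟨r, A, B, a', a'', b', b'', hT⟩
    have : T = fun u => ∏ i, φ ((∑ j, A i j * u.1 j) + a' i * u.2 + a'' i)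
          ((∑ j, B i j * u.1 j) + b' i * u.2 + b'' i) := funext fun u => hT u.1 u.2
    rw [this]
    exact prod_mem_affineProducts _ fun i _ =>
      mem_affineProducts (isIntAffine_of_coeff _ _ _) (isIntAffine_of_coeff _ _ _)

end AffineProducts

section Sums

theorem hasSum_nat_iff {α : Type} {F : α → ℕ} {s : ℕ} :
    HasSum F s ↔ (Function.support F).Finite ∧ s = ∑ᶠ v, F v := by
  constructor
  · intro h
    have hZ : Summable fun v => (F v : ℤ) :=
      (h.map (Nat.castAddMonoidHom ℤ) continuous_of_discreteTopology).summable
    have hfin : (Function.support F).Finite := by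
      have := hZ.hasFiniteSupport_of_discreteTopology
      refine Set.Finite.subset this fun v hv => ?_
      simpa using hv
    exact ⟨hfin, by rw [← h.tsum_eq, tsum_eq_finsum hfin]⟩
  · rintro ⟨hfin, rfl⟩
    rw [← tsum_eq_finsum (L := .unconditional _) hfin]
    exact (summable_of_hasFiniteSupport hfin).hasSum

theorem isBinomialMultisum_iff_hasSum {f : ℕ → ℕ} :
    IsBinomialMultisum f ↔ ∃ d, ∃ T ∈ affineProducts mbinom ((Fin d → ℤ) × ℤ),
      ∀ n : ℕ, HasSum (fun v => T (v, (n : ℤ))) (f n) := by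
  simp only [hasSum_nat_iff]
  constructor
  · rintro ⟨r, d, A, B, a', a'', b', b'', hfin, hf⟩
    exact ⟨d, fun u => ∏ i, mbinom ((∑ j, A i j * u.1 j) + a' i * u.2 + a'' i)
      ((∑ j, B i j * u.1 j) + b' i * u.2 + b'' i), mem_affineProducts_iff_exists_coeff.2
      ⟨r, A, B, a', a'', b', b'', fun v n => rfl⟩, fun n => ⟨hfin n, hf n⟩⟩
  · rintro ⟨d, T, hT, hf⟩
    obtain ⟨r, A, B, a', a'', b', b'', hT⟩ := mem_affineProducts_iff_exists_coeff.1 hT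
    simp only [hT] at hf
    exact ⟨r, d, A, B, a', a'', b', b'', fun n => (hf n).1, fun n => (hf n).2⟩

theorem balancedTerm_eq_prod {r d : ℕ} (B C : Fin r → Fin d → ℤ) (b' b'' c' c'' : Fin r → ℤ)
    (n : ℕ) (v : Fin d → ℤ) :
    balancedTerm B C b' b'' c' c'' n v =
      ∏ i, balancedFactor ((∑ j, B i j * v j) + b' i * (n : ℤ) + b'' i)
        ((∑ j, C i j * v j) + c' i * (n : ℤ) + c'' i) := by
  unfold balancedTerm
  split_ifs with h
  · exact Finset.prod_congr rfl fun i _ => by rw [balancedFactor, if_pos (h i)]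
  · push Not at h
    obtain ⟨i, hi⟩ := h
    refine (Finset.prod_eq_zero (Finset.mem_univ i) ?_).symm
    rw [balancedFactor, if_neg fun h => absurd h.2 (not_le.2 (hi h.1))]

theorem isBalancedPositiveMultisum_iff_hasSum {g : ℕ → ℕ} :
    IsBalancedPositiveMultisum g ↔ ∃ d, ∃ T ∈ affineProducts balancedFactor ((Fin d → ℤ) × ℤ),
      ∀ n : ℕ, HasSum (fun v => T (v, (n : ℤ))) (g n) := by
  simp only [hasSum_nat_iff]
  constructor
  · rintro ⟨r, d, B, C, b', b'', c', c'', hfin, hg⟩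
    refine ⟨d, fun u => ∏ i, balancedFactor ((∑ j, B i j * u.1 j) + b' i * u.2 + b'' i)
      ((∑ j, C i j * u.1 j) + c' i * u.2 + c'' i), mem_affineProducts_iff_exists_coeff.2
      ⟨r, B, C, b', b'', c', c'', fun v n => rfl⟩, fun n => ?_⟩
    simp only [← balancedTerm_eq_prod]
    exact ⟨hfin n, hg n⟩
  · rintro ⟨d, T, hT, hg⟩
    obtain ⟨r, B, C, b', b'', c', c'', hT⟩ := mem_affineProducts_iff_exists_coeff.1 hT
    simp only [hT, ← balancedTerm_eq_prod] at hg
    exact ⟨r, d, B, C, b', b'', c', c'', fun n => (hg n).1, fun n => (hg n).2⟩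

end Sums

section Factors

theorem mbinom_eq_balancedFactor (a b : ℤ) :
    mbinom a b = balancedFactor b (a - b) +
      balancedFactor (a + 1) (-(a + 1)) * balancedFactor b (-b) := by
  have h : b + (a - b) = a := by ring
  unfold mbinom balancedFactor
  rw [h]
  split_ifs <;> first | omega | simp
  have ha : a + 1 = 0 := by omega
  have hb : b = 0 := by omega
  simp [ha, hb]

theorem balancedFactor_eq_mbinom (x y : ℤ) :
    balancedFactor x y = mbinom (x + y) x * mbinom y y := by
  unfold mbinom balancedFactor
  split_ifs <;> first | omega | simp

theorem mbinom_self (x : ℤ) : mbinom x x = if 0 ≤ x then 1 else 0 := by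
  unfold mbinom
  split_ifs <;> first | omega | simp

theorem affineProducts_balancedFactor_le (M : Type) [AddCommGroup M] :
    affineProducts balancedFactor M ≤ affineProducts mbinom M := by
  refine Submonoid.closure_le.2 ?_
  rintro _ ⟨a, b, ha, hb, rfl⟩
  simp only [balancedFactor_eq_mbinom]
  refine mul_mem (mem_affineProducts (a := fun u => a u + b u) (fun u v => ?_) ha)
    (mem_affineProducts hb hb)
  linarith [ha u v, hb u v]

/-- A product of modified binomial coefficients is a finite sum of balanced products. -/
theorem exists_list_balanced {M : Type} [AddCommGroup M] {T : M → ℕ}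
    (hT : T ∈ affineProducts mbinom M) :
    ∃ l : List (M → ℕ), (∀ S ∈ l, S ∈ affineProducts balancedFactor M) ∧ l.sum = T := by
  refine AddSubmonoid.exists_list_of_mem_closure
    ((Submonoid.subsemiringClosure_mem _).1 (?_ : T ∈ Submonoid.subsemiringClosure _))
  have hle : affineProducts mbinom M ≤
      (affineProducts balancedFactor M).subsemiringClosure.toSubmonoid := by
    refine Submonoid.closure_le.2 ?_
    rintro _ ⟨a, b, ha, hb, rfl⟩
    have of_mem {S : M → ℕ} (hS : S ∈ affineProducts balancedFactor M) :
        S ∈ (affineProducts balancedFactor M).subsemiringClosure :=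
      (Submonoid.subsemiringClosure_mem _).2 (AddSubmonoid.subset_closure hS)
    simp only [mbinom_eq_balancedFactor]
    refine add_mem (S := Subsemiring (M → ℕ))
      (of_mem (mem_affineProducts (b := fun u => a u - b u) hb fun u v => ?_))
      (mul_mem
        (of_mem (mem_affineProducts (a := fun u => a u + 1) (b := fun u => -(a u + 1))
          (fun u v => ?_) fun u v => ?_))
        (of_mem (mem_affineProducts (b := fun u => -b u) hb fun u v => ?_))) <;>
    linarith [ha u v, hb u v]
  exact hle hT

/-- For `s ∈ {0, 1}`, the indicator of `x = 0` if `s = 0`, and of `x ≥ 0` if `s = 1`. -/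
def gate (s x : ℤ) : ℕ := mbinom (s + x - 1) x * mbinom s s

theorem gate_zero (x : ℤ) : gate 0 x = if x = 0 then 1 else 0 := by
  unfold gate mbinom
  split_ifs <;> first | omega | simp

theorem gate_one (x : ℤ) : gate 1 x = if 0 ≤ x then 1 else 0 := by
  unfold gate mbinom
  split_ifs <;> first | omega | simp

theorem gate_of_neg {s : ℤ} (hs : s < 0) (x : ℤ) : gate s x = 0 := by
  simp [gate, mbinom_self, hs.not_ge]

theorem gate_mem_affineProducts {M : Type} [AddCommGroup M] {s x : M → ℤ}
    (hs : IsIntAffine s) (hx : IsIntAffine x) :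
    (fun u => gate (s u) (x u)) ∈ affineProducts mbinom M := by
  have h : IsIntAffine fun u => s u + x u - 1 := fun u v => by linarith [hs u v, hx u v]
  unfold gate
  exact mul_mem_affineProducts (mem_affineProducts h hx) (mem_affineProducts hs hs)

end Factors

section Addition

/-- `isBinomialMultisum_iff_hasSum` with an arbitrary lattice as index set. -/
theorem isBinomialMultisum_of_hasSum {V : Type} [AddCommGroup V] [Module.Free ℤ V]
    [Module.Finite ℤ V] {T : V × ℤ → ℕ} (hT : T ∈ affineProducts mbinom (V × ℤ)) {f : ℕ → ℕ}
    (hf : ∀ n : ℕ, HasSum (fun v => T (v, (n : ℤ))) (f n)) : IsBinomialMultisum f := by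
  obtain ⟨d, ⟨e⟩⟩ : ∃ d, Nonempty ((Fin d → ℤ) ≃ₗ[ℤ] V) :=
    ⟨_, ⟨(Module.finBasis ℤ V).equivFun.symm⟩⟩
  have he : IsIntAffine fun u : (Fin d → ℤ) × ℤ => (e u.1, u.2) := fun u v => by simp
  exact isBinomialMultisum_iff_hasSum.2 ⟨d, fun u => T (e u.1, u.2),
    comp_mem_affineProducts hT he,
    fun n => (e.toEquiv.hasSum_iff (f := fun v => T (v, (n : ℤ)))).2 (hf n)⟩

/-- The integer encoded by `(x, y, e)`: for `s = 1` every integer has exactly one encoding with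
`x, y ≥ 0` and `e ∈ {0, 1}` in which `x` (if `e = 0`) or `y` (if `e = 1`) vanishes. -/
def decodeInt (s : ℤ) (c : ℤ × ℤ × ℤ) : ℤ := c.1 - c.2.1 - (s - c.2.2)

/-- The indicator of the valid encodings for `decodeInt`; for `s = 0` only `0` is valid. -/
def encodingGate (s : ℤ) (c : ℤ × ℤ × ℤ) : ℕ := gate c.2.2 c.1 * gate (s - c.2.2) c.2.1

/-- The valid encoding of an integer for `s = 1`. -/
def encodeInt (v : ℤ) : ℤ × ℤ × ℤ := if 0 ≤ v then (v, 0, 1) else (0, -v - 1, 0)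

theorem decodeInt_encodeInt (v : ℤ) : decodeInt 1 (encodeInt v) = v := by
  unfold decodeInt encodeInt
  split_ifs <;> simp

theorem encodingGate_encodeInt (v : ℤ) : encodingGate 1 (encodeInt v) = 1 := by
  unfold encodingGate encodeInt
  split_ifs with h
  · simp [gate_zero, gate_one, h]
  · have : 1 ≤ -v := by omega
    simp [gate_zero, gate_one, this]

theorem encodeInt_decodeInt {c : ℤ × ℤ × ℤ} (hc : encodingGate 1 c ≠ 0) :
    encodeInt (decodeInt 1 c) = c := by
  obtain ⟨x, y, e⟩ := c
  obtain ⟨h₁, h₂⟩ := mul_ne_zero_iff.1 hc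
  simp only at h₁ h₂
  have he : 0 ≤ e := by
    by_contra! h
    exact h₁ (gate_of_neg h _)
  have he' : e ≤ 1 := by
    by_contra! h
    exact h₂ (gate_of_neg (by omega) _)
  obtain rfl | rfl : e = 0 ∨ e = 1 := by omega
  · simp only [gate_zero, sub_zero, gate_one, ne_eq, ite_eq_right_iff, one_ne_zero, imp_false,
      not_not] at h₁ h₂
    subst h₁
    have hy : decodeInt 1 (0, y, 0) = -y - 1 := by simp [decodeInt]
    rw [hy, encodeInt, if_neg (by omega)]
    simp
  · simp only [gate_zero, sub_self, gate_one, ne_eq, ite_eq_right_iff, one_ne_zero, imp_false,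
      not_not] at h₁ h₂
    subst h₂
    simp [decodeInt, encodeInt, h₁]

theorem encodingGate_zero (c : ℤ × ℤ × ℤ) : encodingGate 0 c = if c = 0 then 1 else 0 := by
  obtain ⟨x, y, e⟩ := c
  simp only [encodingGate, zero_sub]
  rcases lt_trichotomy e 0 with he | rfl | he
  · simp [gate_of_neg he, he.ne]
  · simp only [gate_zero, neg_zero, Prod.mk_eq_zero, and_true]
    split_ifs <;> simp_all
  · simp [gate_of_neg (neg_lt_zero.2 he), he.ne']

/-- A binomial multisum can be equipped with a switch variable `s`: for `s = 1` it is unchanged, and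
for `s = 0` and `n = 0` it degenerates to the single term `1` at the origin. -/
theorem IsBinomialMultisum.exists_switch {f : ℕ → ℕ} (hf : IsBinomialMultisum f) :
    ∃ d, ∃ T ∈ affineProducts mbinom ((Fin d → ℤ × ℤ × ℤ) × ℤ × ℤ),
      (∀ n : ℕ, HasSum (fun w => T (w, (n : ℤ), 1)) (f n)) ∧
      ∀ w, T (w, 0, 0) = if w = 0 then 1 else 0 := by
  obtain ⟨d, T, hT, hf⟩ := isBinomialMultisum_iff_hasSum.1 hf
  obtain ⟨S, hS, hST, hS₀⟩ := exists_homogenization (by simp [mbinom]) hT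
  refine ⟨d, fun u => S ((fun j => decodeInt u.2.2 (u.1 j), u.2.1), u.2.2) *
    ∏ j, encodingGate u.2.2 (u.1 j), ?_, fun n => ?_, fun w => ?_⟩
  · refine mul_mem_affineProducts (comp_mem_affineProducts hS
      (h := fun u : (Fin d → ℤ × ℤ × ℤ) × ℤ × ℤ =>
        ((fun j => decodeInt u.2.2 (u.1 j), u.2.1), u.2.2)) fun u v => ?_)
      (prod_mem_affineProducts _ fun j _ => mul_mem_affineProducts
        (gate_mem_affineProducts (fun u v => ?_) fun u v => ?_)
        (gate_mem_affineProducts (fun u v => ?_) fun u v => ?_))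
    · ext
      · simp [decodeInt]
        ring
      · simp
      · simp
    all_goals simp
    ring
  · have hinj : Function.Injective fun (v : Fin d → ℤ) j => encodeInt (v j) := fun v w h => by
      ext j
      rw [← decodeInt_encodeInt (v j), ← decodeInt_encodeInt (w j)]
      exact congrArg _ (congrFun h j)
    refine (hinj.hasSum_iff fun w hw => ?_).1 ?_
    · contrapose! hw
      have hw := Finset.prod_ne_zero_iff.1 (mul_ne_zero_iff.1 hw).2
      exact ⟨fun j => decodeInt 1 (w j),
        funext fun j => encodeInt_decodeInt (hw j (Finset.mem_univ j))⟩
    · simpa [Function.comp_def, decodeInt_encodeInt, encodingGate_encodeInt, hST] using hf n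
  · simp only [encodingGate_zero]
    split_ifs with hw
    · subst hw
      have : (fun _ : Fin d => decodeInt 0 0) = 0 := by
        ext
        simp [decodeInt]
      simpa [this, ← Prod.zero_eq_mk] using hS₀
    · obtain ⟨j, hj⟩ := Function.ne_iff.1 hw
      exact mul_eq_zero_of_right _ (Finset.prod_eq_zero (Finset.mem_univ j) (if_neg hj))

/-- The index lattice of the sum of two switched multisums: their own variables, the part of `n`
passed on to the first one, and its switch. -/
abbrev SumIndex (d₁ d₂ : ℕ) : Type := (Fin d₁ → ℤ × ℤ × ℤ) × (Fin d₂ → ℤ × ℤ × ℤ) × ℤ × ℤ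

theorem IsBinomialMultisum.add {f g : ℕ → ℕ} (hf : IsBinomialMultisum f)
    (hg : IsBinomialMultisum g) : IsBinomialMultisum (f + g) := by
  obtain ⟨d₁, T₁, hT₁, hf, h₁⟩ := hf.exists_switch
  obtain ⟨d₂, T₂, hT₂, hg, h₂⟩ := hg.exists_switch
  let T : SumIndex d₁ d₂ × ℤ → ℕ := fun u =>
    T₁ (u.1.1, u.1.2.2.1, u.1.2.2.2) * T₂ (u.1.2.1, u.2 - u.1.2.2.1, 1 - u.1.2.2.2) *
      gate u.1.2.2.2 u.1.2.2.1 * gate (1 - u.1.2.2.2) (u.2 - u.1.2.2.1)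
  have hT : T ∈ affineProducts mbinom _ := by
    refine mul_mem_affineProducts (mul_mem_affineProducts (mul_mem_affineProducts
      (comp_mem_affineProducts hT₁ (h := fun u : SumIndex d₁ d₂ × ℤ => (u.1.1, u.1.2.2.1, u.1.2.2.2)) fun u v => ?_)
      (comp_mem_affineProducts hT₂
        (h := fun u : SumIndex d₁ d₂ × ℤ => (u.1.2.1, u.2 - u.1.2.2.1, 1 - u.1.2.2.2))
        fun u v => ?_))
      (gate_mem_affineProducts (fun u v => ?_) fun u v => ?_))
      (gate_mem_affineProducts (fun u v => ?_) fun u v => ?_)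
    · ext <;> simp
    · simp only [Prod.fst_add, Prod.snd_add, Prod.fst_zero, Prod.snd_zero, Prod.mk_add_mk,
        Prod.mk.injEq, add_zero, true_and]
      constructor <;> ring
    all_goals simp
    all_goals ring
  refine isBinomialMultisum_of_hasSum hT fun n => ?_
  let ι : (Fin d₁ → ℤ × ℤ × ℤ) ⊕ (Fin d₂ → ℤ × ℤ × ℤ) → SumIndex d₁ d₂ :=
    Sum.elim (fun w => (w, 0, (n : ℤ), 1)) fun w => (0, w, 0, 0)
  have hι : Function.Injective ι := by
    rintro (w | w) (w' | w') h <;> simp_all [ι]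
  refine (hι.hasSum_iff fun u hu => ?_).1 (HasSum.sum ?_ ?_)
  · contrapose! hu
    obtain ⟨w₁, w₂, m, s⟩ := u
    simp only [T, mul_ne_zero_iff] at hu
    obtain ⟨⟨⟨k₁, k₂⟩, k₃⟩, k₄⟩ := hu
    have hs : 0 ≤ s := by
      by_contra! h
      exact k₃ (gate_of_neg h _)
    have hs' : s ≤ 1 := by
      by_contra! h
      exact k₄ (gate_of_neg (by omega) _)
    obtain rfl | rfl : s = 0 ∨ s = 1 := by omega
    · obtain rfl : m = 0 := by simpa [gate_zero] using k₃
      obtain rfl : w₁ = 0 := by simpa [h₁] using k₁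
      exact ⟨.inr w₂, rfl⟩
    · obtain rfl : m = n := by
        have : (n : ℤ) - m = 0 := by simpa [gate_zero] using k₄
        omega
      obtain rfl : w₂ = 0 := by simpa [h₂] using k₂
      exact ⟨.inl w₁, rfl⟩
  · simpa [Function.comp_def, ι, T, gate_zero, gate_one, h₂] using hf n
  · simpa [Function.comp_def, ι, T, gate_zero, gate_one, h₁] using hg n

theorem isBinomialMultisum_zero : IsBinomialMultisum 0 :=
  isBinomialMultisum_of_hasSum (V := ℤ) (T := fun _ => mbinom (-2) 0)
    (mem_affineProducts (fun _ _ => rfl) fun _ _ => rfl) fun _ => by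
      simp [mbinom]

theorem IsBalancedPositiveMultisum.isBinomialMultisum {g : ℕ → ℕ}
    (hg : IsBalancedPositiveMultisum g) : IsBinomialMultisum g := by
  obtain ⟨d, T, hT, hg⟩ := isBalancedPositiveMultisum_iff_hasSum.1 hg
  exact isBinomialMultisum_iff_hasSum.2 ⟨d, T, affineProducts_balancedFactor_le _ hT, hg⟩

end Addition

/-- **𝓑 = 𝓑′**: a function is a binomial multisum if and only if it is a finite sum
of balanced positive multisums. -/
theorem binomialMultisum_iff_sum_balancedPositiveMultisums (f : ℕ → ℕ) :
    IsBinomialMultisum f ↔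
      ∃ (k : ℕ) (g : Fin k → ℕ → ℕ),
        (∀ j, IsBalancedPositiveMultisum (g j)) ∧ ∀ n, f n = ∑ j, g j n := by
  constructor
  · intro hf
    obtain ⟨d, T, hT, hf⟩ := isBinomialMultisum_iff_hasSum.1 hf
    obtain ⟨l, hl, rfl⟩ := exists_list_balanced hT
    have hsum (u : (Fin d → ℤ) × ℤ) : l.sum u = ∑ i, l.get i u := by
      rw [← Finset.sum_apply, ← List.sum_ofFn, List.ofFn_get]
    simp only [hsum] at hf
    have hS (i : Fin l.length) (n : ℕ) : Summable fun v => l.get i (v, (n : ℤ)) := by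
      refine summable_of_hasFiniteSupport ((hasSum_nat_iff.1 (hf n)).1.subset fun v hv => ?_)
      exact fun h => hv (Finset.sum_eq_zero_iff.1 h i (Finset.mem_univ i))
    exact ⟨l.length, fun i n => ∑' v, l.get i (v, (n : ℤ)),
      fun i => isBalancedPositiveMultisum_iff_hasSum.2
        ⟨d, l.get i, hl _ (l.get_mem i), fun n => (hS i n).hasSum⟩,
      fun n => (hf n).unique (hasSum_sum fun i _ => (hS i n).hasSum)⟩
  · rintro ⟨k, g, hg, hf⟩
    obtain rfl : f = ∑ j, g j := funext fun n => by rw [hf, Finset.sum_apply]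
    exact Finset.sum_induction _ _ (fun _ _ => IsBinomialMultisum.add) isBinomialMultisum_zero
      fun j _ => (hg j).isBinomialMultisum
end

section
/- Let f : ℕ → ℕ be a binomial multisum. Then there exists an integer m ≥ 1 such that for every i with 0 ≤ i ≤ m-1, the function f_i(n) := f(n·m + i) either grows exponentially (there exist constants c₁, c₂ > 0 and N ∈ ℕ such that e^{c₁·n} ≤ f_i(n) ≤ e^{c₂·n} for all n ≥ N) or is eventually polynomial (there exist N ∈ ℕ and a polynomial q with rational coefficients such that f_i(n) = q(n) for all n ≥ N). -/
section

open Filter Polynomial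

/-- `h` is eventually quasi-polynomial: it agrees eventually with a polynomial on each residue
class modulo some period. -/
def EventuallyQuasiPoly (h : ℤ → ℚ) : Prop :=
  ∃ m : ℕ, 0 < m ∧ ∀ i : ℤ, ∃ q : ℚ[X], ∀ᶠ n : ℕ in atTop, h (n * m + i) = q.eval (n : ℚ)

/-- Every rational polynomial is the forward difference of a polynomial. -/
theorem Polynomial.exists_eval_add_one_sub_eval (q : ℚ[X]) :
    ∃ Q : ℚ[X], ∀ x : ℚ, Q.eval (x + 1) - Q.eval x = q.eval x := by
  induction q using Polynomial.induction_on' with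
  | add p q hp hq =>
    obtain ⟨P, hP⟩ := hp
    obtain ⟨Q, hQ⟩ := hq
    refine ⟨P + Q, fun x => ?_⟩
    simp only [eval_add, ← hP, ← hQ]
    ring
  | monomial k a =>
    refine ⟨C (a / (k + 1)) * Polynomial.bernoulli (k + 1), fun x => ?_⟩
    have := Polynomial.bernoulli_eval_one_add (k + 1) x
    rw [add_comm x 1]
    simp only [eval_mul, eval_C, this, eval_monomial]
    push_cast
    field_simp
    simp only [add_sub_cancel_left]
    ring

namespace EventuallyQuasiPoly

/-- The period may be replaced by any positive multiple. -/
theorem eval_of_dvd {h : ℤ → ℚ} {m M : ℕ}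
    (hm : ∀ i : ℤ, ∃ q : ℚ[X], ∀ᶠ n : ℕ in atTop, h (n * m + i) = q.eval (n : ℚ))
    (hM : 0 < M) (hd : m ∣ M) (i : ℤ) :
    ∃ q : ℚ[X], ∀ᶠ n : ℕ in atTop, h (n * M + i) = q.eval (n : ℚ) := by
  obtain ⟨k, rfl⟩ := hd
  obtain ⟨q, hq⟩ := hm i
  refine ⟨q.comp (C (k : ℚ) * X), ?_⟩
  have hk : 0 < k := Nat.pos_of_mul_pos_left hM
  have ht : Tendsto (fun n : ℕ => k * n) atTop atTop := tendsto_id.const_mul_atTop' hk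
  filter_upwards [ht.eventually hq] with n hn
  simp only [eval_comp, eval_mul, eval_C, eval_X]
  push_cast at hn ⊢
  rw [← hn]
  congr 1
  ring

theorem of_eventually_zero {h : ℤ → ℚ} (hh : ∀ᶠ n : ℤ in atTop, h n = 0) :
    EventuallyQuasiPoly h := by
  refine ⟨1, one_pos, fun i => ⟨0, ?_⟩⟩
  have ht : Tendsto (fun n : ℕ => (n : ℤ) * ((1 : ℕ) : ℤ) + i) atTop atTop := by
    simpa using tendsto_atTop_add_const_right atTop i tendsto_natCast_atTop_atTop
  filter_upwards [ht.eventually hh] with n hn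
  simpa using hn

theorem add {h h' : ℤ → ℚ} (hh : EventuallyQuasiPoly h) (hh' : EventuallyQuasiPoly h') :
    EventuallyQuasiPoly (fun n => h n + h' n) := by
  obtain ⟨m, hm, H⟩ := hh
  obtain ⟨m', hm', H'⟩ := hh'
  refine ⟨m * m', Nat.mul_pos hm hm', fun i => ?_⟩
  obtain ⟨q, hq⟩ := eval_of_dvd H (Nat.mul_pos hm hm') (dvd_mul_right m m') i
  obtain ⟨q', hq'⟩ := eval_of_dvd H' (Nat.mul_pos hm hm') (dvd_mul_left m' m) i
  refine ⟨q + q', ?_⟩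
  filter_upwards [hq, hq'] with n hn hn'
  rw [eval_add, hn, hn']

theorem neg {h : ℤ → ℚ} (hh : EventuallyQuasiPoly h) : EventuallyQuasiPoly (fun n => - h n) := by
  obtain ⟨m, hm, H⟩ := hh
  refine ⟨m, hm, fun i => ?_⟩
  obtain ⟨q, hq⟩ := H i
  refine ⟨-q, ?_⟩
  filter_upwards [hq] with n hn
  rw [eval_neg, hn]

theorem shift {h : ℤ → ℚ} (hh : EventuallyQuasiPoly h) (a : ℤ) :
    EventuallyQuasiPoly (fun n => h (n + a)) := by
  obtain ⟨m, hm, H⟩ := hh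
  refine ⟨m, hm, fun i => ?_⟩
  obtain ⟨q, hq⟩ := H (i + a)
  refine ⟨q, ?_⟩
  filter_upwards [hq] with n hn
  rw [← hn, add_assoc]

theorem finset_sum {ι : Type*} (s : Finset ι) {h : ι → ℤ → ℚ}
    (hh : ∀ k ∈ s, EventuallyQuasiPoly (h k)) : EventuallyQuasiPoly (fun n => ∑ k ∈ s, h k n) := by
  classical
  induction s using Finset.induction_on with
  | empty => exact of_eventually_zero (by simp)
  | insert a s ha ih =>
    simp only [Finset.sum_insert ha]
    exact (hh a (Finset.mem_insert_self a s)).add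
      (ih fun k hk => hh k (Finset.mem_insert_of_mem hk))

/-- A function with an eventually quasi-polynomial difference is eventually quasi-polynomial. -/
theorem of_sub {h : ℤ → ℚ} {t : ℤ} (ht : 0 < t)
    (hh : EventuallyQuasiPoly (fun n => h (n + t) - h n)) : EventuallyQuasiPoly h := by
  obtain ⟨m, hm, H⟩ := hh
  lift t to ℕ using ht.le
  have ht' : 0 < t := by exact_mod_cast ht
  refine ⟨m * t, Nat.mul_pos hm ht', fun i => ?_⟩
  choose q hq using fun j : ℕ =>
    eval_of_dvd (h := fun n => h (n + t) - h n) H (Nat.mul_pos hm ht') (dvd_mul_right m t) (i + j * t)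
  obtain ⟨Q, hQ⟩ := Polynomial.exists_eval_add_one_sub_eval (∑ j ∈ Finset.range m, q j)
  have hall : ∀ᶠ n : ℕ in atTop, ∀ j ∈ Finset.range m,
      h (n * (m * t : ℕ) + (i + j * t) + t) - h (n * (m * t : ℕ) + (i + j * t)) =
        (q j).eval (n : ℚ) :=
    (Finset.range m).eventually_all.2 fun j _ => hq j
  obtain ⟨N, hN⟩ := eventually_atTop.1 hall
  refine ⟨Q + C (h (N * (m * t : ℕ) + i) - Q.eval (N : ℚ)), ?_⟩
  filter_upwards [eventually_ge_atTop N] with n hn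
  induction n, hn using Nat.le_induction with
  | base => simp
  | succ n hn ih =>
    have h1 := Finset.sum_congr rfl (hN n hn)
    have h2 := Finset.sum_range_sub
      (fun j : ℕ => h (n * (m * t : ℕ) + (i + j * t))) m
    have h3 : ∑ j ∈ Finset.range m, (h (n * (m * t : ℕ) + (i + j * t) + t) -
        h (n * (m * t : ℕ) + (i + j * t))) = h ((n + 1 : ℕ) * (m * t : ℕ) + i) -
        h (n * (m * t : ℕ) + i) := by
      convert h2 using 3
      · push_cast; ring_nf
      · push_cast; ring_nf
      · push_cast; ring_nf
    have h4 := hQ n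
    rw [eval_finsetSum, ← h1, h3] at h4
    simp only [eval_add, eval_C] at ih ⊢
    push_cast at *
    linarith

end EventuallyQuasiPoly

/-- Functions on an additive group whose `e`-fold iterated differences all vanish. -/
def DiffNilpotent {V : Type*} [AddCommGroup V] : ℕ → (V → ℚ) → Prop
  | 0, w => ∀ x, w x = 0
  | e + 1, w => ∀ g, DiffNilpotent e (fun x => w (x + g) - w x)

namespace DiffNilpotent

variable {V : Type*} [AddCommGroup V]

theorem zero (e : ℕ) : DiffNilpotent e (fun _ : V => (0 : ℚ)) := by
  induction e with
  | zero => exact fun _ => rfl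
  | succ e ih => intro g; simpa using ih

theorem add {e : ℕ} {w w' : V → ℚ} (hw : DiffNilpotent e w) (hw' : DiffNilpotent e w') :
    DiffNilpotent e (fun x => w x + w' x) := by
  induction e generalizing w w' with
  | zero => intro x; simp [hw x, hw' x]
  | succ e ih =>
    intro g
    convert ih (hw g) (hw' g) using 2
    ring

theorem comp_add {e : ℕ} {w : V → ℚ} (hw : DiffNilpotent e w) (a : V) :
    DiffNilpotent e (fun x => w (x + a)) := by
  induction e generalizing w with
  | zero => exact fun x => hw _
  | succ e ih =>
    intro g
    convert ih (hw g) using 4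
    abel

theorem succ {e : ℕ} {w : V → ℚ} (hw : DiffNilpotent e w) : DiffNilpotent (e + 1) w := by
  induction e generalizing w with
  | zero => intro g x; simp [hw x, hw (x + g)]
  | succ e ih => exact fun g => ih (hw g)

theorem mono {e e' : ℕ} (he : e ≤ e') {w : V → ℚ} (hw : DiffNilpotent e w) :
    DiffNilpotent e' w := by
  induction e', he using Nat.le_induction with
  | base => exact hw
  | succ n _ ih => exact ih.succ

theorem mul {e e' : ℕ} {w w' : V → ℚ} (hw : DiffNilpotent e w) (hw' : DiffNilpotent e' w') :
    DiffNilpotent (e + e') (fun x => w x * w' x) := by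
  induction k : e + e' generalizing e e' w w' with
  | zero =>
    obtain rfl : e = 0 := by omega
    intro x
    simp [hw x]
  | succ k ih =>
    rcases e with _ | e
    · have : w = fun _ => 0 := funext hw
      simpa [this] using zero _
    rcases e' with _ | e'
    · have : w' = fun _ => 0 := funext hw'
      simpa [this] using zero _
    intro g
    have h1 := ih (hw g) (hw'.comp_add g) (by omega)
    have h2 := ih hw (hw' g) (by omega)
    convert h1.add h2 using 2
    ring

theorem const (c : ℚ) : DiffNilpotent 1 (fun _ : V => c) := by
  intro g x
  simp

theorem addMonoidHom (l : V →+ ℤ) : DiffNilpotent 2 (fun x => (l x : ℚ)) := by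
  intro g g' x
  simp

theorem exists_eval_comp {e : ℕ} {w : V → ℚ} (hw : DiffNilpotent e w) (p : ℚ[X]) :
    ∃ e', DiffNilpotent e' (fun x => p.eval (w x)) := by
  induction p using Polynomial.induction_on' with
  | add p q hp hq =>
    obtain ⟨a, ha⟩ := hp
    obtain ⟨b, hb⟩ := hq
    simp only [eval_add]
    exact ⟨max a b, (ha.mono (le_max_left a b)).add (hb.mono (le_max_right a b))⟩
  | monomial k a =>
    induction k with
    | zero => exact ⟨1, by simpa using const a⟩
    | succ k ih =>
      obtain ⟨b, hb⟩ := ih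
      refine ⟨b + e, ?_⟩
      convert hb.mul hw using 2
      simp only [eval_monomial]
      ring

theorem exists_prod {ι : Type*} (s : Finset ι) {w : ι → V → ℚ}
    (hw : ∀ i ∈ s, ∃ e, DiffNilpotent e (w i)) :
    ∃ e, DiffNilpotent e (fun x => ∏ i ∈ s, w i x) := by
  classical
  induction s using Finset.induction_on with
  | empty => exact ⟨1, by simpa using const 1⟩
  | insert a s ha ih =>
    obtain ⟨b, hb⟩ := hw a (Finset.mem_insert_self a s)
    obtain ⟨c, hc⟩ := ih fun k hk => hw k (Finset.mem_insert_of_mem hk)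
    simp only [Finset.prod_insert ha]
    exact ⟨b + c, hb.mul hc⟩

end DiffNilpotent

/-- If elements of `Q` carry codes in a well-quasi-order which refine the relation `R`, then `Q` has
a finite subset `R`-below all its elements. -/
theorem exists_finite_basis {V β : Type*} {r : β → β → Prop} (hr : WellQuasiOrdered r)
    (Q : Set V) (R : V → V → Prop) (code : V → β)
    (hcode : ∀ x ∈ Q, ∀ y ∈ Q, r (code x) (code y) → R x y) :
    ∃ F : Set V, F.Finite ∧ F ⊆ Q ∧ ∀ y ∈ Q, ∃ x ∈ F, R x y := by
  by_contra hcon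
  obtain ⟨f, hf, hlt⟩ := exists_seq_of_forall_finset_exists (· ∈ Q) (fun x y => ¬ R x y) (by
    intro s hs
    by_contra h
    refine hcon ⟨s, s.finite_toSet, hs, fun y hy => ?_⟩
    by_contra h'
    exact h ⟨y, hy, fun x hx hR => h' ⟨x, hx, hR⟩⟩)
  obtain ⟨m, n, hmn, hle⟩ := hr (fun k => code (f k))
  exact hlt m n hmn (hcode _ (hf m) _ (hf n) hle)

section FiberSums

variable {V : Type*} [AddCommGroup V]

/-- A subset of a finitely generated set is itself covered by translates of the generating monoid
by finitely many of its own elements. -/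
theorem exists_finite_generators {G F Q : Set V} (hG : G.Finite) (hF : F.Finite)
    (hQ : ∀ x ∈ Q, ∃ b ∈ F, ∃ y ∈ AddSubmonoid.closure G, x = b + y) :
    ∃ F' : Set V, F'.Finite ∧ F' ⊆ Q ∧
      ∀ x ∈ Q, ∃ b ∈ F', ∃ y ∈ AddSubmonoid.closure G, x = b + y := by
  classical
  lift G to Finset V using hG
  have hF' : Finite F := hF
  have hQ' : ∀ x ∈ Q, ∃ b : F, ∃ k : V → ℕ, x = b + ∑ a ∈ G, k a • a := by
    intro x hx
    obtain ⟨b, hb, y, hy, rfl⟩ := hQ x hx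
    obtain ⟨k, -, rfl⟩ := AddSubmonoid.mem_closure_finset.1 hy
    exact ⟨⟨b, hb⟩, k, rfl⟩
  choose! b k hbk using fun x (hx : x ∈ Q) => hQ' x hx
  rcases Q.eq_empty_or_nonempty with rfl | ⟨x₀, hx₀⟩
  · exact ⟨∅, Set.finite_empty, subset_rfl, by simp⟩
  have hne : Nonempty F := ⟨b x₀ hx₀⟩
  have hw : WellQuasiOrdered (fun p q : F × (G → ℕ) => p.1 = q.1 ∧ p.2 ≤ q.2) :=
    WellQuasiOrdered.prod (Finite.wellQuasiOrdered _) wellQuasiOrdered_le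
  refine exists_finite_basis hw Q (fun x z => ∃ y ∈ AddSubmonoid.closure (G : Set V), z = x + y)
    (fun x => if hx : x ∈ Q then (b x hx, fun a => k x a) else (hne.some, 0)) ?_
  intro x hx z hz hxz
  simp only [hx, hz, dif_pos] at hxz
  obtain ⟨h1, h2⟩ := hxz
  refine ⟨∑ a ∈ G, (k z a - k x a) • a, sum_mem fun a ha =>
    nsmul_mem (AddSubmonoid.subset_closure ha) _, ?_⟩
  have h3 : ∑ a ∈ G, k z a • a = ∑ a ∈ G, k x a • a + ∑ a ∈ G, (k z a - k x a) • a := by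
    rw [← Finset.sum_add_distrib]
    refine Finset.sum_congr rfl fun a ha => ?_
    rw [← add_smul, Nat.add_sub_cancel' (h2 ⟨a, ha⟩)]
  calc z = b x hx + (∑ a ∈ G, k x a • a + ∑ a ∈ G, (k z a - k x a) • a) := by
        rw [h1, ← h3]; exact hbk z hz
    _ = x + ∑ a ∈ G, (k z a - k x a) • a := by rw [← add_assoc, ← hbk x hx]

/-- Convexity of `Q` for the translation preorder of the monoid generated by `G`. -/
def TranslationConvex (G Q : Set V) : Prop :=
  ∀ x ∈ Q, ∀ u ∈ AddSubmonoid.closure G, ∀ v ∈ AddSubmonoid.closure G, x + u + v ∈ Q → x + u ∈ Q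

theorem TranslationConvex.mono {G G' Q : Set V} (h : TranslationConvex G Q) (hG : G' ⊆ G) :
    TranslationConvex G' Q := fun x hx u hu v hv =>
  h x hx u (AddSubmonoid.closure_mono hG hu) v (AddSubmonoid.closure_mono hG hv)

/-- The sum of `w` over the points of `Q` of degree `n`. -/
noncomputable def fiberSum (t : V →+ ℤ) (Q : Set V) (w : V → ℚ) (n : ℤ) : ℚ :=
  ∑ᶠ x ∈ {x | x ∈ Q ∧ t x = n}, w x

theorem fiberSum_add_sub (t : V →+ ℤ) {Q : Set V} (hfin : ∀ n, {x | x ∈ Q ∧ t x = n}.Finite)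
    (w : V → ℚ) (g : V) (n : ℤ) :
    fiberSum t Q w (n + t g) - fiberSum t Q w n =
      fiberSum t {x | x ∈ Q ∧ x - g ∉ Q} w (n + t g) + fiberSum t Q (fun x => w (x + g) - w x) n
        + -fiberSum t {x | x ∈ Q ∧ x + g ∉ Q} (fun x => w (x + g)) n := by
  unfold fiberSum
  have h1 := finsum_mem_inter_add_sdiff (f := w) {x | x - g ∈ Q} (hfin (n + t g))
  have h2 := finsum_mem_inter_add_sdiff (f := fun x => w (x + g)) {x | x + g ∈ Q} (hfin n)
  have h3 : ∑ᶠ x ∈ {x | x ∈ Q ∧ t x = n}, (w (x + g) - w x) =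
      ∑ᶠ x ∈ {x | x ∈ Q ∧ t x = n}, w (x + g) - ∑ᶠ x ∈ {x | x ∈ Q ∧ t x = n}, w x :=
    finsum_mem_sub_distrib _ _ (hfin n)
  have h4 : ∑ᶠ x ∈ {x | x ∈ Q ∧ t x = n + t g} ∩ {x | x - g ∈ Q}, w x =
      ∑ᶠ x ∈ {x | x ∈ Q ∧ t x = n} ∩ {x | x + g ∈ Q}, w (x + g) := by
    rw [← finsum_mem_image (f := w) (g := fun x => x + g) (add_left_injective g).injOn]
    refine finsum_mem_congr ?_ fun _ _ => rfl
    ext x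
    constructor
    · rintro ⟨⟨hx, ht⟩, hxg⟩
      refine ⟨x - g, ⟨⟨hxg, ?_⟩, ?_⟩, by simp⟩
      · rw [map_sub, ht]; ring
      · simpa using hx
    · rintro ⟨y, ⟨⟨hy, ht⟩, hyg⟩, rfl⟩
      exact ⟨⟨hyg, by simp [ht]⟩, by simpa using hy⟩
  have h5 : {x | x ∈ Q ∧ t x = n + t g} \ {x | x - g ∈ Q} =
      {x | x ∈ {x | x ∈ Q ∧ x - g ∉ Q} ∧ t x = n + t g} := by
    ext x; simp only [Set.mem_sdiff, Set.mem_ofPred_eq]; tauto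
  have h6 : {x | x ∈ Q ∧ t x = n} \ {x | x + g ∈ Q} =
      {x | x ∈ {x | x ∈ Q ∧ x + g ∉ Q} ∧ t x = n} := by
    ext x; simp only [Set.mem_sdiff, Set.mem_ofPred_eq]; tauto
  rw [h5, h4] at h1
  rw [h6] at h2
  rw [h3, ← h1, ← h2]
  ring

/-- A convex set without two points differing by `g` is covered without using the generator `g`. -/
theorem exists_generators_of_insert {g : V} {G F Q : Set V} (hG : G.Finite) (hF : F.Finite)
    (hconv : TranslationConvex (insert g G) Q)
    (hQ : ∀ x ∈ Q, ∃ b ∈ F, ∃ y ∈ AddSubmonoid.closure (insert g G), x = b + y)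
    (hg : ∀ x ∈ Q, x + g ∉ Q) :
    ∃ F' : Set V, F'.Finite ∧ ∀ x ∈ Q, ∃ b ∈ F', ∃ y ∈ AddSubmonoid.closure G, x = b + y := by
  obtain ⟨F', hF', hF'Q, hcov⟩ := exists_finite_generators (hG.insert g) hF hQ
  refine ⟨F', hF', fun x hx => ?_⟩
  obtain ⟨b, hb, y, hy, rfl⟩ := hcov x hx
  rw [Set.insert_eq, AddSubmonoid.closure_union, AddSubmonoid.mem_sup] at hy
  obtain ⟨u, hu, v, hv, rfl⟩ := hy
  obtain ⟨k, rfl⟩ := AddSubmonoid.mem_closure_singleton.1 hu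
  rcases k with _ | k
  · exact ⟨b, hb, v, hv, by simp⟩
  · have hgm : g ∈ AddSubmonoid.closure (insert g G) :=
      AddSubmonoid.subset_closure (Set.mem_insert g G)
    refine absurd (hconv b (hF'Q hb) g hgm (k • g + v) (add_mem (nsmul_mem hgm k)
      (AddSubmonoid.closure_mono (Set.subset_insert g G) hv)) ?_) (hg b (hF'Q hb))
    convert hx using 1
    rw [succ_nsmul]
    abel

/-- Weighted fibre sums of convex subsets of finitely generated sets are eventually
quasi-polynomial. -/
theorem eventuallyQuasiPoly_fiberSum (t : V →+ ℤ) {G : Set V} (hG : G.Finite)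
    (hpos : ∀ g ∈ G, 0 < t g) {Q F : Set V} (hF : F.Finite) (hconv : TranslationConvex G Q)
    (hQ : ∀ x ∈ Q, ∃ b ∈ F, ∃ y ∈ AddSubmonoid.closure G, x = b + y)
    (hfin : ∀ n, {x | x ∈ Q ∧ t x = n}.Finite) {e : ℕ} {w : V → ℚ} (hw : DiffNilpotent e w) :
    EventuallyQuasiPoly (fiberSum t Q w) := by
  induction G, hG using Set.Finite.induction_on generalizing Q F e w with
  | empty =>
    have hQF : Q ⊆ F := by
      intro x hx
      obtain ⟨b, hb, y, hy, rfl⟩ := hQ x hx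
      rw [AddSubmonoid.closure_empty, AddSubmonoid.mem_bot] at hy
      simpa [hy] using hb
    obtain ⟨N, hN⟩ := (hF.image t).bddAbove
    refine EventuallyQuasiPoly.of_eventually_zero ?_
    filter_upwards [eventually_gt_atTop N] with n hn
    refine finsum_mem_eq_zero_of_forall_eq_zero ?_
    rintro x ⟨hx, rfl⟩
    exact absurd (hN ⟨x, hQF hx, rfl⟩) (not_le.2 hn)
  | @insert g G hgG hG ih =>
    have hgm : g ∈ AddSubmonoid.closure (insert g G) :=
      AddSubmonoid.subset_closure (Set.mem_insert g G)
    have hpos' : ∀ a ∈ G, 0 < t a := fun a ha => hpos a (Set.mem_insert_of_mem g ha)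
    have of_subset : ∀ Q' ⊆ Q, TranslationConvex (insert g G) Q' → (∀ x ∈ Q', x + g ∉ Q') →
        ∀ (e : ℕ) (w : V → ℚ), DiffNilpotent e w → EventuallyQuasiPoly (fiberSum t Q' w) := by
      intro Q' hsub hc hanti e w hw
      obtain ⟨F', hF', hcov⟩ := exists_generators_of_insert hG hF hc
        (fun x hx => hQ x (hsub hx)) hanti
      exact ih hpos' hF' (hc.mono (Set.subset_insert g G)) hcov
        (fun n => (hfin n).subset fun x hx => ⟨hsub hx.1, hx.2⟩) hw
    have hC := of_subset {x | x ∈ Q ∧ x - g ∉ Q} (fun x hx => hx.1) (by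
      rintro x ⟨hx, -⟩ u hu v hv ⟨hxuv, hn⟩
      refine ⟨hconv x hx u hu v hv hxuv, fun h => hn ?_⟩
      have := hconv (x + u - g) h v hv g hgm (by convert hxuv using 1; abel)
      convert this using 1; abel) (fun x hx h => h.2 (by simpa using hx.1))
    have hK := of_subset {x | x ∈ Q ∧ x + g ∉ Q} (fun x hx => hx.1) (by
      rintro x ⟨hx, hxg⟩ u hu v hv ⟨hxuv, -⟩
      refine ⟨hconv x hx u hu v hv hxuv, fun h => hxg ?_⟩
      exact hconv x hx g hgm u hu (by convert h using 1; abel)) (fun x hx h => hx.2 h.1)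
    induction e generalizing w with
    | zero =>
      refine EventuallyQuasiPoly.of_eventually_zero (Eventually.of_forall fun n => ?_)
      exact finsum_mem_eq_zero_of_forall_eq_zero fun x _ => hw x
    | succ e ihe =>
      refine EventuallyQuasiPoly.of_sub (hpos g (Set.mem_insert g G)) ?_
      simp only [fiberSum_add_sub t hfin w g]
      exact (((hC _ _ hw).shift (t g)).add (ihe (hw g))).add (hK _ _ (hw.comp_add g)).neg

/-- Fibre sums may be computed on the level sets of a function with finite range on `Q`. -/
theorem fiberSum_eq_sum_levels {ι : Type*} [DecidableEq ι] (t : V →+ ℤ) {Q : Set V}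
    (hfin : ∀ n, {x | x ∈ Q ∧ t x = n}.Finite) (κ : V → ι) (s : Finset ι)
    (hκ : ∀ x ∈ Q, κ x ∈ s) (w : V → ℚ) (n : ℤ) :
    fiberSum t Q w n = ∑ k ∈ s, fiberSum t {x | x ∈ Q ∧ κ x = k} w n := by
  have hfin' : ∀ k, {x | x ∈ {x | x ∈ Q ∧ κ x = k} ∧ t x = n}.Finite := fun k =>
    (hfin n).subset fun x hx => ⟨hx.1.1, hx.2⟩
  simp only [fiberSum]
  rw [finsum_mem_eq_finite_toFinset_sum _ (hfin n),
    ← Finset.sum_fiberwise_of_maps_to (t := s) (g := κ) (by simpa using fun x hx _ => hκ x hx)]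
  refine Finset.sum_congr rfl fun k _ => ?_
  rw [finsum_mem_eq_finite_toFinset_sum _ (hfin' k)]
  refine Finset.sum_congr ?_ fun _ _ => rfl
  ext x
  simp only [Finset.mem_filter, Set.Finite.mem_toFinset, Set.mem_ofPred_eq]
  tauto

end FiberSums

/-- The lattice points of a polyhedron with finite fibres are finitely generated, by recession
directions of positive degree. -/
theorem exists_generators_of_polyhedron {V J : Type*} [AddCommGroup V] [IsAddTorsionFree V]
    [Finite J] (t : V →+ ℤ) (l : J → V →+ ℤ) (c : J → ℤ) {P : Set V}
    (hP : ∀ x, x ∈ P ↔ ∀ j, 0 ≤ l j x + c j) (hfin : ∀ n, {x | x ∈ P ∧ t x = n}.Finite)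
    (ht : ∀ y, (∀ j, 0 ≤ l j y) → 0 ≤ t y) :
    ∃ F G : Set V, F.Finite ∧ G.Finite ∧ F ⊆ P ∧ (∀ g ∈ G, (∀ j, 0 ≤ l j g) ∧ 0 < t g) ∧
      ∀ x ∈ P, ∃ b ∈ F, ∃ y ∈ AddSubmonoid.closure G, x = b + y := by
  rcases P.eq_empty_or_nonempty with rfl | ⟨x₀, hx₀⟩
  · exact ⟨∅, ∅, Set.finite_empty, Set.finite_empty, subset_rfl, by simp, by simp⟩
  have hw : WellQuasiOrdered (fun p q : J → ℕ => p ≤ q) := wellQuasiOrdered_le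
  have hker : ∀ y, (∀ j, 0 ≤ l j y) → t y = 0 → y = 0 := by
    intro y hy hty
    by_contra hne
    refine Set.infinite_of_injective_forall_mem (f := fun k : ℕ => x₀ + k • y) ?_ ?_ (hfin (t x₀))
    · intro k k' hkk
      have h : k • y = k' • y := add_left_cancel hkk
      have h' : (k : ℤ) • y = (k' : ℤ) • y := by simpa using h
      exact_mod_cast smul_left_injective ℤ hne h'
    · intro k
      refine ⟨(hP _).2 fun j => ?_, by simp [hty]⟩
      have h1 := (hP x₀).1 hx₀ j
      have h2 := mul_nonneg (Int.natCast_nonneg k) (hy j)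
      simp only [map_add, map_nsmul, nsmul_eq_mul]
      linarith
  obtain ⟨F, hF, hFP, hFcov⟩ := exists_finite_basis hw P (fun x y => ∀ j, 0 ≤ l j (y - x))
    (fun x j => (l j x + c j).toNat) (by
      intro x hx y hy hxy j
      have h1 := hxy j
      have h2 := (hP x).1 hx j
      have h3 := (hP y).1 hy j
      simp only [map_sub] at h1 ⊢
      omega)
  obtain ⟨G, hG, hGM, hGcov⟩ := exists_finite_basis hw {y | (∀ j, 0 ≤ l j y) ∧ 0 < t y}
    (fun x y => ∀ j, 0 ≤ l j (y - x)) (fun x j => (l j x).toNat) (by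
      intro x hx y hy hxy j
      have h1 := hxy j
      have h2 := hx.1 j
      have h3 := hy.1 j
      simp only [map_sub] at h1 ⊢
      omega)
  refine ⟨F, G, hF, hG, hFP, hGM, fun x hx => ?_⟩
  obtain ⟨b, hb, hbx⟩ := hFcov x hx
  refine ⟨b, hb, x - b, ?_, by abel⟩
  generalize x - b = y at hbx
  induction hn : (t y).toNat using Nat.strong_induction_on generalizing y with
  | _ n ih =>
    rcases (ht y hbx).eq_or_lt with h0 | hpos
    · rw [hker y hbx h0.symm]
      exact zero_mem _
    · obtain ⟨g, hg, hgy⟩ := hGcov y ⟨hbx, hpos⟩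
      have htg := (hGM hg).2
      have := ht _ hgy
      have hyg := ih _ (by rw [map_sub] at *; omega) (y - g) hgy rfl
      simpa using add_mem hyg (AddSubmonoid.subset_closure hg)

theorem mbinom_of_le {a b : ℤ} (h0 : 0 ≤ b) (h : b ≤ a) :
    mbinom a b = a.toNat.choose b.toNat := if_pos ⟨h0, h⟩

theorem mbinom_neg_one_zero : mbinom (-1) 0 = 1 := rfl

theorem mbinom_ne_zero_iff {a b : ℤ} : mbinom a b ≠ 0 ↔ (0 ≤ b ∧ b ≤ a) ∨ (a = -1 ∧ b = 0) := by
  unfold mbinom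
  split_ifs with h1 h2
  · simp only [h1, and_self, true_or, iff_true]
    exact (Nat.choose_pos (by omega)).ne'
  · simp [h2]
  · simp [h1, h2]

theorem mbinom_le_two_pow (a b : ℤ) : mbinom a b ≤ 2 ^ a.natAbs := by
  unfold mbinom
  split_ifs with h1 h2
  · have : a.toNat = a.natAbs := by omega
    rw [this]
    exact Nat.choose_le_two_pow _ _
  · exact Nat.one_le_two_pow
  · exact Nat.zero_le _

theorem Nat.two_pow_le_choose_add {k b c : ℕ} (hb : k ≤ b) (hc : k ≤ c) :
    2 ^ k ≤ (b + c).choose b := by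
  induction k generalizing b c with
  | zero => exact Nat.choose_pos (by omega)
  | succ k ih =>
    obtain ⟨b, rfl⟩ : ∃ b', b = b' + 1 := ⟨b - 1, by omega⟩
    obtain ⟨c, rfl⟩ : ∃ c', c = c' + 1 := ⟨c - 1, by omega⟩
    have h1 := ih (b := b) (c := c + 1) (by omega) (by omega)
    have h2 := ih (b := b + 1) (c := c) (by omega) (by omega)
    rw [show b + 1 + (c + 1) = (b + (c + 1)) + 1 by ring, Nat.choose_succ_succ, pow_succ]
    rw [show b + 1 + c = b + (c + 1) by ring] at h2
    rw [Nat.succ_eq_add_one]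
    omega

theorem two_pow_le_mbinom {k : ℕ} {a b : ℤ} (hb : k ≤ b) (ha : k ≤ a - b) :
    2 ^ k ≤ mbinom a b := by
  rw [mbinom_of_le (by omega) (by omega)]
  have := Nat.two_pow_le_choose_add (k := k) (b := b.toNat) (c := (a - b).toNat)
    (by omega) (by omega)
  rwa [show b.toNat + (a - b).toNat = a.toNat by omega] at this

theorem Nat.exists_polynomial_choose (k : ℕ) :
    ∃ p : ℚ[X], ∀ n : ℕ, (n.choose k : ℚ) = p.eval (n : ℚ) := by
  refine ⟨C ((k.factorial : ℚ)⁻¹) * descPochhammer ℚ k, fun n => ?_⟩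
  rw [eval_mul, eval_C, Nat.cast_choose_eq_descPochhammer_div]
  field_simp

section BinomialProducts

variable {V ι : Type*} [AddCommGroup V] [Fintype ι] [DecidableEq ι]

/-- A product of modified binomial coefficients of affine functions `α i + a i`, `β i + b i`. -/
def binomProd (α β : ι → V →+ ℤ) (a b : ι → ℤ) (x : V) : ℕ :=
  ∏ i, mbinom (α i x + a i) (β i x + b i)

/-- The points of nonnegative degree with nonzero product. -/
def binomSupport (t : V →+ ℤ) (α β : ι → V →+ ℤ) (a b : ι → ℤ) : Set V :=
  {x | 0 ≤ t x ∧ binomProd α β a b x ≠ 0}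

/-- The factors with upper entry `-1`. -/
def negOneFactors (α : ι → V →+ ℤ) (a : ι → ℤ) (x : V) : Finset ι :=
  Finset.univ.filter fun i => α i x + a i = -1

/-- The part of the support on which exactly the factors in `S` have upper entry `-1`. -/
def binomPiece (t : V →+ ℤ) (α β : ι → V →+ ℤ) (a b : ι → ℤ) (S : Finset ι) : Set V :=
  {x | x ∈ binomSupport t α β a b ∧ negOneFactors α a x = S}

variable {t : V →+ ℤ} {α β : ι → V →+ ℤ} {a b : ι → ℤ}

theorem mem_binomPiece_iff {S : Finset ι} {x : V} : x ∈ binomPiece t α β a b S ↔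
    0 ≤ t x ∧ (∀ i ∈ S, α i x + a i = -1 ∧ β i x + b i = 0) ∧
      ∀ i ∉ S, 0 ≤ β i x + b i ∧ β i x + b i ≤ α i x + a i := by
  simp only [binomPiece, binomSupport, binomProd, negOneFactors, Set.mem_ofPred_eq,
    Finset.prod_ne_zero_iff, mbinom_ne_zero_iff, Finset.mem_univ, true_implies]
  constructor
  · rintro ⟨⟨h1, h2⟩, rfl⟩
    simp only [Finset.mem_filter, Finset.mem_univ, true_and]
    refine ⟨h1, fun i hi => ?_, fun i hi => ?_⟩ <;> have := h2 i <;> omega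
  · rintro ⟨h1, h2, h3⟩
    refine ⟨⟨h1, fun i => ?_⟩, ?_⟩
    · by_cases hi : i ∈ S
      · exact Or.inr (h2 i hi)
      · exact Or.inl (h3 i hi)
    · ext i
      simp only [Finset.mem_filter, Finset.mem_univ, true_and]
      by_cases hi : i ∈ S
      · simp [hi, h2 i hi]
      · have := h3 i hi
        simp only [hi, iff_false]
        omega

/-- Finite generation of a piece of the support. -/
theorem exists_generators_binomPiece [IsAddTorsionFree V]
    (hfin : ∀ n, {x | x ∈ binomSupport t α β a b ∧ t x = n}.Finite) (S : Finset ι) :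
    ∃ F G : Set V, F.Finite ∧ G.Finite ∧ F ⊆ binomPiece t α β a b S ∧ (∀ g ∈ G, 0 < t g) ∧
      (∀ g ∈ G, ∀ i ∉ S, 0 ≤ β i g ∧ 0 ≤ (α i - β i) g) ∧
      (∀ x ∈ binomPiece t α β a b S, ∃ y ∈ F, ∃ z ∈ AddSubmonoid.closure G, x = y + z) ∧
      ∀ x ∈ binomPiece t α β a b S, ∀ z ∈ AddSubmonoid.closure G,
        x + z ∈ binomPiece t α β a b S := by
  let l : Option (ι × Fin 4) → V →+ ℤ := fun j => j.elim t fun p =>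
    if p.1 ∈ S then ![α p.1, -α p.1, β p.1, -β p.1] p.2
    else ![β p.1, α p.1 - β p.1, β p.1, α p.1 - β p.1] p.2
  let c : Option (ι × Fin 4) → ℤ := fun j => j.elim 0 fun p =>
    if p.1 ∈ S then ![a p.1 + 1, -(a p.1 + 1), b p.1, -b p.1] p.2
    else ![b p.1, a p.1 - b p.1, b p.1, a p.1 - b p.1] p.2
  have hP : ∀ x, x ∈ binomPiece t α β a b S ↔ ∀ j, 0 ≤ l j x + c j := by
    intro x
    simp only [mem_binomPiece_iff, Option.forall, Prod.forall, Fin.forall_fin_succ, l, c,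
      Option.elim_none, Option.elim_some, add_zero]
    refine and_congr_right fun _ => ?_
    rw [← forall_and]
    refine forall_congr' fun i => ?_
    by_cases hi : i ∈ S
    · simp [hi]; omega
    · simp [hi]; omega
  obtain ⟨F, G, hF, hG, hFP, hGl, hcov⟩ := exists_generators_of_polyhedron t l c hP
    (fun n => (hfin n).subset fun x hx => ⟨hx.1.1, hx.2⟩) (fun y hy => hy none)
  refine ⟨F, G, hF, hG, hFP, fun g hg => (hGl g hg).2, fun g hg i hi => ?_, hcov, ?_⟩
  · have h0 := (hGl g hg).1 (some (i, 0))
    have h1 := (hGl g hg).1 (some (i, 1))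
    simp only [l, Option.elim_some, hi, if_false] at h0 h1
    exact ⟨h0, h1⟩
  · intro x hx z hz
    have hz' : ∀ j, 0 ≤ l j z := by
      intro j
      induction hz using AddSubmonoid.closure_induction with
      | mem g hg => exact (hGl g hg).1 j
      | zero => simp
      | add u v _ _ hu hv => rw [map_add]; exact add_nonneg hu hv
    refine (hP _).2 fun j => ?_
    have h1 := (hP x).1 hx j
    have h2 := hz' j
    rw [map_add]
    omega

/-- Additive forms grow at most linearly in the degree on the support. -/
theorem exists_linear_bound_binomSupport [IsAddTorsionFree V]
    (hfin : ∀ n, {x | x ∈ binomSupport t α β a b ∧ t x = n}.Finite) (l : V →+ ℤ) :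
    ∃ C : ℕ, ∀ x ∈ binomSupport t α β a b, |l x| ≤ C * (t x + 1) := by
  have hpiece : ∀ S : Finset ι, ∃ C : ℕ, ∀ x ∈ binomPiece t α β a b S, |l x| ≤ C * (t x + 1) := by
    intro S
    obtain ⟨F, G, hF, hG, hFP, hpos, -, hcov, -⟩ := exists_generators_binomPiece hfin S
    obtain ⟨K, hK⟩ := (hF.image fun x => (l x).natAbs).bddAbove
    obtain ⟨K', hK'⟩ := (hG.image fun x => (l x).natAbs).bddAbove
    refine ⟨K + K', fun x hx => ?_⟩
    obtain ⟨y, hy, z, hz, rfl⟩ := hcov x hx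
    have h1 : (l y).natAbs ≤ K := hK ⟨y, hy, rfl⟩
    have h1' : |l y| ≤ K := by rw [Int.abs_eq_natAbs]; exact_mod_cast h1
    have h2 : |l z| ≤ K' * t z ∧ 0 ≤ t z := by
      clear hx
      induction hz using AddSubmonoid.closure_induction with
      | mem g hg =>
        have h3 : (l g).natAbs ≤ K' := hK' ⟨g, hg, rfl⟩
        have h3' : |l g| ≤ K' := by rw [Int.abs_eq_natAbs]; exact_mod_cast h3
        have h4 := hpos g hg
        exact ⟨by nlinarith, h4.le⟩
      | zero => simp
      | add u v _ _ hu hv =>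
        rw [map_add, map_add]
        exact ⟨by linarith [abs_add_le (l u) (l v)], by linarith⟩
    have h3 := (mem_binomPiece_iff.1 (hFP hy)).1
    rw [map_add, map_add]
    have h4 := abs_add_le (l y) (l z)
    have h5 := mul_nonneg (Int.natCast_nonneg K) h3
    have h6 := mul_nonneg (Int.natCast_nonneg K) h2.2
    have h7 := mul_nonneg (Int.natCast_nonneg K') h3
    push_cast
    nlinarith [Int.natCast_nonneg K']
  choose C hC using hpiece
  refine ⟨∑ S, C S, fun x hx => (hC (negOneFactors α a x) x ⟨hx, rfl⟩).trans ?_⟩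
  refine mul_le_mul_of_nonneg_right ?_ (by linarith [hx.1])
  exact_mod_cast Finset.single_le_sum (f := C) (fun _ _ => Nat.zero_le _) (Finset.mem_univ _)

/-- If each factor has a lower entry (or co-entry) that is constant along the generators, the
fibre sums over the piece are eventually quasi-polynomial. -/
theorem eventuallyQuasiPoly_binomPiece
    (hfin : ∀ n, {x | x ∈ binomSupport t α β a b ∧ t x = n}.Finite) {S : Finset ι} {F G : Set V}
    (hF : F.Finite) (hG : G.Finite) (hpos : ∀ g ∈ G, 0 < t g)
    (hcov : ∀ x ∈ binomPiece t α β a b S, ∃ y ∈ F, ∃ z ∈ AddSubmonoid.closure G, x = y + z)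
    (habs : ∀ x ∈ binomPiece t α β a b S, ∀ z ∈ AddSubmonoid.closure G,
      x + z ∈ binomPiece t α β a b S)
    (hconst : ∀ i ∉ S, (∀ g ∈ G, β i g = 0) ∨ ∀ g ∈ G, (α i - β i) g = 0) :
    EventuallyQuasiPoly
      (fiberSum t (binomPiece t α β a b S) fun x => (binomProd α β a b x : ℚ)) := by
  classical
  have hfactor : ∀ i, ∃ γ : V →+ ℤ, (∀ g ∈ G, γ g = 0) ∧ ∀ z : ℤ, ∃ w : V → ℚ,
      (∃ e, DiffNilpotent e w) ∧ ∀ x ∈ binomPiece t α β a b S, γ x = z →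
        (mbinom (α i x + a i) (β i x + b i) : ℚ) = w x := by
    intro i
    by_cases hi : i ∈ S
    · refine ⟨0, by simp, fun z => ⟨fun _ => 1, ⟨1, DiffNilpotent.const 1⟩, fun x hx _ => ?_⟩⟩
      obtain ⟨h1, h2⟩ := (mem_binomPiece_iff.1 hx).2.1 i hi
      rw [h1, h2, mbinom_neg_one_zero, Nat.cast_one]
    have hpoly : ∀ k : ℕ, ∃ w : V → ℚ, (∃ e, DiffNilpotent e w) ∧
        ∀ x ∈ binomPiece t α β a b S, ((α i x + a i).toNat.choose k : ℚ) = w x := by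
      intro k
      obtain ⟨p, hp⟩ := Nat.exists_polynomial_choose k
      refine ⟨fun x => p.eval ((α i x : ℚ) + a i), DiffNilpotent.exists_eval_comp
        ((DiffNilpotent.addMonoidHom (α i)).add (DiffNilpotent.const (a i : ℚ)).succ) p,
        fun x hx => ?_⟩
      have h := (mem_binomPiece_iff.1 hx).2.2 i hi
      rw [hp, ← Int.cast_natCast, Int.toNat_of_nonneg (h.1.trans h.2), Int.cast_add]
    rcases hconst i hi with h | h
    · refine ⟨β i, h, fun z => ?_⟩
      obtain ⟨w, hw, hwx⟩ := hpoly (z + b i).toNat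
      refine ⟨w, hw, fun x hx hz => ?_⟩
      have h' := (mem_binomPiece_iff.1 hx).2.2 i hi
      rw [mbinom_of_le h'.1 h'.2, hz, hwx x hx]
    · refine ⟨α i - β i, h, fun z => ?_⟩
      obtain ⟨w, hw, hwx⟩ := hpoly (z + a i - b i).toNat
      refine ⟨w, hw, fun x hx hz => ?_⟩
      have h' := (mem_binomPiece_iff.1 hx).2.2 i hi
      rw [mbinom_of_le h'.1 h'.2, ← hwx x hx, ← Nat.choose_symm (by omega), ← hz]
      congr 2
      simp only [AddMonoidHom.sub_apply]
      omega
  choose γ hγ w hw hwx using hfactor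
  have hγ' : ∀ i, ∀ z ∈ AddSubmonoid.closure G, γ i z = 0 := by
    intro i z hz
    induction hz using AddSubmonoid.closure_induction with
    | mem g hg => exact hγ i g hg
    | zero => simp
    | add u v _ _ hu hv => rw [map_add, hu, hv, add_zero]
  have hfinP : ∀ n, {x | x ∈ binomPiece t α β a b S ∧ t x = n}.Finite := fun n =>
    (hfin n).subset fun x hx => ⟨hx.1.1, hx.2⟩
  have hlevels := fiberSum_eq_sum_levels t hfinP (fun x i => γ i x)
    (hF.toFinset.image fun x i => γ i x) (by
      intro x hx
      obtain ⟨y, hy, z, hz, rfl⟩ := hcov x hx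
      refine Finset.mem_image.2 ⟨y, hF.mem_toFinset.2 hy, funext fun i => ?_⟩
      rw [map_add, hγ' i z hz, add_zero]) fun x => (binomProd α β a b x : ℚ)
  rw [funext hlevels]
  refine EventuallyQuasiPoly.finset_sum _ fun k _ => ?_
  obtain ⟨e, he⟩ := DiffNilpotent.exists_prod Finset.univ fun i _ => hw i (k i)
  have hcongr : (fiberSum t {x | x ∈ binomPiece t α β a b S ∧ (fun i => γ i x) = k}
      fun x => (binomProd α β a b x : ℚ)) =
      fiberSum t {x | x ∈ binomPiece t α β a b S ∧ (fun i => γ i x) = k}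
        fun x => ∏ i, w i (k i) x := by
    funext n
    refine finsum_mem_congr rfl fun x hx => ?_
    rw [binomProd, Nat.cast_prod]
    exact Finset.prod_congr rfl fun i _ => hwx i (k i) x hx.1.1 (congrFun hx.1.2 i)
  rw [hcongr]
  refine eventuallyQuasiPoly_fiberSum t hG hpos hF ?_ (fun x hx => hcov x hx.1)
    (fun n => (hfinP n).subset fun x hx => ⟨hx.1.1, hx.2⟩) he
  rintro x ⟨hx, rfl⟩ u hu v _ _
  refine ⟨habs x hx u hu, funext fun i => ?_⟩
  rw [map_add, hγ' i u hu, add_zero]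

/-- Every piece either grows exponentially along some direction, or has eventually quasi-polynomial
fibre sums. -/
theorem binomPiece_dichotomy [IsAddTorsionFree V]
    (hfin : ∀ n, {x | x ∈ binomSupport t α β a b ∧ t x = n}.Finite) (S : Finset ι) :
    (∃ p, 0 < t p ∧ ∀ x ∈ binomPiece t α β a b S, ∀ k : ℕ,
      x + k • p ∈ binomPiece t α β a b S ∧ 2 ^ k ≤ binomProd α β a b (x + k • p)) ∨
    EventuallyQuasiPoly
      (fiberSum t (binomPiece t α β a b S) fun x => (binomProd α β a b x : ℚ)) := by
  obtain ⟨F, G, hF, hG, -, hpos, hsign, hcov, habs⟩ := exists_generators_binomPiece hfin S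
  by_cases hconst : ∀ i ∉ S, (∀ g ∈ G, β i g = 0) ∨ ∀ g ∈ G, (α i - β i) g = 0
  · exact Or.inr (eventuallyQuasiPoly_binomPiece hfin hF hG hpos hcov habs hconst)
  left
  push Not at hconst
  obtain ⟨i, hi, ⟨g, hg, hβ⟩, g', hg', hαβ⟩ := hconst
  have hgpos := hpos g hg
  have hgpos' := hpos g' hg'
  refine ⟨g + g', by rw [map_add]; omega, fun x hx k => ?_⟩
  have hmem : x + k • (g + g') ∈ binomPiece t α β a b S :=
    habs x hx _ (nsmul_mem (add_mem (AddSubmonoid.subset_closure hg)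
      (AddSubmonoid.subset_closure hg')) k)
  refine ⟨hmem, ?_⟩
  have hle : mbinom (α i (x + k • (g + g')) + a i) (β i (x + k • (g + g')) + b i) ≤
      binomProd α β a b (x + k • (g + g')) :=
    Finset.single_le_prod' (f := fun i => mbinom (α i (x + k • (g + g')) + a i)
      (β i (x + k • (g + g')) + b i)) (fun j _ => Nat.one_le_iff_ne_zero.2
        (Finset.prod_ne_zero_iff.1 hmem.1.2 j (Finset.mem_univ j))) (Finset.mem_univ i)
  refine le_trans (two_pow_le_mbinom ?_ ?_) hle
  all_goals
    have h1 := hsign g hg i hi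
    have h2 := hsign g' hg' i hi
    have h3 := (mem_binomPiece_iff.1 hx).2.2 i hi
    simp only [AddMonoidHom.sub_apply] at h1 h2 hαβ
    simp only [map_add, map_nsmul, nsmul_eq_mul]
  · have h4 : 1 ≤ β i g + β i g' := by omega
    nlinarith [Int.natCast_nonneg k]
  · have h4 : 1 ≤ (α i g - β i g) + (α i g' - β i g') := by omega
    nlinarith [Int.natCast_nonneg k]

end BinomialProducts

/-- Fibre sums of binomial products grow at most exponentially. -/
theorem exists_two_pow_bound {d : ℕ} {ι : Type*} [Fintype ι] [DecidableEq ι]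
    {t : (Fin d → ℤ) × ℤ →+ ℤ} (ht : ∀ x, t x = x.2) {α β : ι → (Fin d → ℤ) × ℤ →+ ℤ}
    {a b : ι → ℤ} (hfin : ∀ n, {x | x ∈ binomSupport t α β a b ∧ t x = n}.Finite) :
    ∃ K : ℕ, ∀ n : ℕ, ∑ x ∈ (hfin n).toFinset, binomProd α β a b x ≤ 2 ^ (K * (n + 1)) := by
  choose c hc using fun j : Fin d => exists_linear_bound_binomSupport hfin
    ((Pi.evalAddMonoidHom (fun _ : Fin d => ℤ) j).comp (AddMonoidHom.fst (Fin d → ℤ) ℤ))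
  choose c' hc' using fun i => exists_linear_bound_binomSupport hfin (α i)
  let B : ℕ := ∑ j, c j
  refine ⟨2 * B * d + ∑ i, (c' i + (a i).natAbs), fun n => ?_⟩
  have hcard : (hfin n).toFinset.card ≤ 2 ^ (2 * B * d * (n + 1)) := by
    have h1 : (hfin n).toFinset.card ≤ (Fintype.piFinset fun _ : Fin d =>
        Finset.Icc (-((B * (n + 1) : ℕ) : ℤ)) ((B * (n + 1) : ℕ) : ℤ)).card := by
      refine Finset.card_le_card_of_injOn Prod.fst ?_ ?_
      · intro x hx
        obtain ⟨hx, hxn⟩ := (hfin n).mem_toFinset.1 hx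
        refine Fintype.mem_piFinset.2 fun j => ?_
        have h2 : |x.1 j| ≤ c j * (t x + 1) := hc j x hx
        have h3 : (c j : ℤ) ≤ B := by
          exact_mod_cast Finset.single_le_sum (f := c) (fun _ _ => Nat.zero_le _)
            (Finset.mem_univ j)
        rw [hxn] at h2
        rw [Finset.mem_Icc, ← abs_le]
        push_cast
        exact h2.trans (mul_le_mul_of_nonneg_right h3 (by positivity))
      · intro x hx y hy hxy
        have h2 := ((hfin n).mem_toFinset.1 hx).2
        have h3 := ((hfin n).mem_toFinset.1 hy).2
        rw [ht] at h2 h3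
        exact Prod.ext hxy (h2.trans h3.symm)
    refine h1.trans ?_
    rw [Fintype.card_piFinset, Finset.prod_const, Finset.card_univ, Fintype.card_fin, Int.card_Icc,
      show 2 * B * d * (n + 1) = (2 * (B * (n + 1))) * d by ring, pow_mul]
    refine Nat.pow_le_pow_left ?_ d
    have := Nat.lt_two_pow_self (n := 2 * (B * (n + 1)))
    omega
  have hterm : ∀ x ∈ (hfin n).toFinset,
      binomProd α β a b x ≤ 2 ^ ((∑ i, (c' i + (a i).natAbs)) * (n + 1)) := by
    intro x hx
    obtain ⟨hx, hxn⟩ := (hfin n).mem_toFinset.1 hx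
    rw [Finset.sum_mul, ← Finset.prod_pow_eq_pow_sum]
    refine Finset.prod_le_prod' fun i _ => (mbinom_le_two_pow _ _).trans ?_
    refine Nat.pow_le_pow_right two_pos ?_
    have h1 := hc' i x hx
    rw [hxn, Int.abs_eq_natAbs] at h1
    have h2 : (α i x).natAbs ≤ c' i * (n + 1) := by exact_mod_cast h1
    calc (α i x + a i).natAbs ≤ (α i x).natAbs + (a i).natAbs := Int.natAbs_add_le _ _
      _ ≤ c' i * (n + 1) + (a i).natAbs * (n + 1) :=
        add_le_add h2 (Nat.le_mul_of_pos_right _ n.succ_pos)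
      _ = (c' i + (a i).natAbs) * (n + 1) := by ring
  calc ∑ x ∈ (hfin n).toFinset, binomProd α β a b x
      ≤ (hfin n).toFinset.card * 2 ^ ((∑ i, (c' i + (a i).natAbs)) * (n + 1)) := by
        simpa using Finset.sum_le_card_nsmul _ _ _ hterm
    _ ≤ 2 ^ (2 * B * d * (n + 1)) * 2 ^ ((∑ i, (c' i + (a i).natAbs)) * (n + 1)) :=
        Nat.mul_le_mul_right _ hcard
    _ = _ := by rw [← pow_add]; congr 1; ring

/-- The growth dichotomy for fibre sums of binomial products, with exponential growth expressed by
powers of two. -/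
theorem fiberSum_binomProd_dichotomy {V ι : Type*} [AddCommGroup V] [IsAddTorsionFree V]
    [Fintype ι] [DecidableEq ι] {t : V →+ ℤ} {α β : ι → V →+ ℤ} {a b : ι → ℤ}
    (hfin : ∀ n, {x | x ∈ binomSupport t α β a b ∧ t x = n}.Finite) :
    ∃ m : ℕ, 0 < m ∧ ∀ i : ℕ,
      (∃ n₀ : ℕ, ∀ n ≥ n₀, 2 ^ (n - n₀) ≤
        ∑ x ∈ (hfin (n * m + i : ℕ)).toFinset, binomProd α β a b x) ∨
      ∃ q : ℚ[X], ∀ᶠ n : ℕ in atTop,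
        ((∑ x ∈ (hfin (n * m + i : ℕ)).toFinset, binomProd α β a b x : ℕ) : ℚ) =
          q.eval (n : ℚ) := by
  classical
  let W : V → ℚ := fun x => (binomProd α β a b x : ℚ)
  let P : Finset ι → Set V := binomPiece t α β a b
  have hdich : ∀ S, ∃ T : ℕ, 0 < T ∧ (EventuallyQuasiPoly (fiberSum t (P S) W) ∨
      ∃ p, t p = T ∧ ∀ x ∈ P S, ∀ k : ℕ,
        x + k • p ∈ P S ∧ 2 ^ k ≤ binomProd α β a b (x + k • p)) := by
    intro S
    rcases binomPiece_dichotomy hfin S with ⟨p, hp, h⟩ | h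
    · exact ⟨(t p).toNat, by omega, Or.inr ⟨p, by omega, h⟩⟩
    · exact ⟨1, one_pos, Or.inl h⟩
  choose T hT hdich using hdich
  obtain ⟨m₁, hm₁, hpoly⟩ := EventuallyQuasiPoly.finset_sum
    (Finset.univ.filter fun S => EventuallyQuasiPoly (fiberSum t (P S) W))
    (h := fun S => fiberSum t (P S) W) (fun S hS => (Finset.mem_filter.1 hS).2)
  have hm : 0 < (∏ S, T S) * m₁ := Nat.mul_pos (Finset.prod_pos fun S _ => hT S) hm₁
  refine ⟨(∏ S, T S) * m₁, hm, fun i => ?_⟩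
  by_cases hex : ∃ S, ¬ EventuallyQuasiPoly (fiberSum t (P S) W) ∧ ∃ x ∈ P S, ∃ n₀ : ℕ,
      t x = (n₀ * ((∏ S, T S) * m₁) + i : ℕ)
  · left
    obtain ⟨S, hS, x, hx, n₀, hn₀⟩ := hex
    obtain ⟨p, hp, hgrow⟩ := (hdich S).resolve_left hS
    obtain ⟨r, hr⟩ : T S ∣ (∏ S, T S) * m₁ :=
      (Finset.dvd_prod_of_mem T (Finset.mem_univ S)).mul_right m₁
    rw [hr] at hn₀ hm ⊢
    have hr0 : 0 < r := Nat.pos_of_mul_pos_left hm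
    refine ⟨n₀, fun n hn => ?_⟩
    obtain ⟨k, rfl⟩ := Nat.exists_eq_add_of_le hn
    obtain ⟨hmem, hle⟩ := hgrow x hx (k * r)
    rw [Nat.add_sub_cancel_left]
    calc 2 ^ k ≤ 2 ^ (k * r) := Nat.pow_le_pow_right two_pos (Nat.le_mul_of_pos_right k hr0)
      _ ≤ binomProd α β a b (x + (k * r) • p) := hle
      _ ≤ _ := Finset.single_le_sum (f := binomProd α β a b) (fun _ _ => Nat.zero_le _)
        ((hfin _).mem_toFinset.2 ⟨hmem.1, ?_⟩)
    rw [map_add, map_nsmul, hn₀, hp, nsmul_eq_mul]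
    push_cast
    ring
  · right
    push Not at hex
    obtain ⟨q, hq⟩ := EventuallyQuasiPoly.eval_of_dvd
      (h := fun n => ∑ S ∈ Finset.univ.filter (fun S => EventuallyQuasiPoly (fiberSum t (P S) W)),
        fiberSum t (P S) W n) hpoly hm (dvd_mul_left m₁ _) i
    refine ⟨q, ?_⟩
    filter_upwards [hq] with n hn
    rw [← hn]
    have h1 := fiberSum_eq_sum_levels t hfin (negOneFactors α a) Finset.univ
      (fun x _ => Finset.mem_univ _) W (n * ((∏ S, T S) * m₁) + i : ℕ)
    rw [fiberSum, finsum_mem_eq_finite_toFinset_sum _ (hfin _)] at h1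
    rw [Nat.cast_sum, h1, Finset.sum_filter]
    refine Finset.sum_congr rfl fun S _ => ?_
    split_ifs with hS
    · push_cast
      rfl
    · refine finsum_mem_eq_zero_of_forall_eq_zero ?_
      rintro x ⟨hx, hxn⟩
      exact absurd hxn (hex S hS x hx n)

/-- A binomial multisum is a fibre sum of a binomial product over `ℤ^d × ℤ`. -/
theorem IsBinomialMultisum.exists_binomProd {f : ℕ → ℕ} (hf : IsBinomialMultisum f) :
    ∃ (r d : ℕ) (α β : Fin r → (Fin d → ℤ) × ℤ →+ ℤ) (a b : Fin r → ℤ)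
      (hfin : ∀ n, {x | x ∈ binomSupport (AddMonoidHom.snd (Fin d → ℤ) ℤ) α β a b ∧
        AddMonoidHom.snd (Fin d → ℤ) ℤ x = n}.Finite),
      ∀ n : ℕ, f n = ∑ x ∈ (hfin n).toFinset, binomProd α β a b x := by
  obtain ⟨r, d, A, B, a', a'', b', b'', hsupp, hsum⟩ := hf
  let form (L : Fin r → Fin d → ℤ) (l : Fin r → ℤ) (i : Fin r) : (Fin d → ℤ) × ℤ →+ ℤ :=
    AddMonoidHom.mk' (fun x => ∑ j, L i j * x.1 j + l i * x.2) (by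
      intro x y
      simp only [Prod.fst_add, Prod.snd_add, Pi.add_apply, mul_add, Finset.sum_add_distrib]
      ring)
  have hterm : ∀ (n : ℕ) (v : Fin d → ℤ),
      binomProd (form A a') (form B b') a'' b'' (v, (n : ℤ)) =
        multisumTerm A B a' a'' b' b'' n v := fun _ _ => rfl
  have hbij : ∀ n : ℕ, Set.BijOn (fun v : Fin d → ℤ => (v, (n : ℤ)))
      (Function.support (multisumTerm A B a' a'' b' b'' n))
      {x | x ∈ binomSupport (AddMonoidHom.snd (Fin d → ℤ) ℤ) (form A a') (form B b') a'' b'' ∧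
        AddMonoidHom.snd (Fin d → ℤ) ℤ x = n} := by
    intro n
    refine ⟨fun v hv => ⟨⟨Int.natCast_nonneg n, ?_⟩, rfl⟩, fun v _ v' _ h => (Prod.ext_iff.1 h).1,
      ?_⟩
    · rw [hterm]
      exact hv
    · rintro ⟨v, _⟩ ⟨⟨-, hx⟩, rfl⟩
      exact ⟨v, hx, rfl⟩
  have hfin : ∀ n, {x | x ∈ binomSupport (AddMonoidHom.snd (Fin d → ℤ) ℤ) (form A a') (form B b')
      a'' b'' ∧ AddMonoidHom.snd (Fin d → ℤ) ℤ x = n}.Finite := by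
    intro n
    rcases lt_or_ge n 0 with hn | hn
    · convert Set.finite_empty
      rw [Set.eq_empty_iff_forall_notMem]
      rintro x ⟨⟨h0, -⟩, rfl⟩
      exact absurd h0 (not_le.2 hn)
    · lift n to ℕ using hn
      rw [← (hbij n).image_eq]
      exact (hsupp n).image _
  refine ⟨r, d, form A a', form B b', a'', b'', hfin, fun n => ?_⟩
  rw [hsum n, ← finsum_mem_support, ← finsum_mem_eq_finite_toFinset_sum _ (hfin n)]
  exact finsum_mem_eq_of_bijOn _ (hbij n) fun v _ => (hterm n v).symm

end

/-- **Growth dichotomy** for binomial multisums (= tile counting functions): there is an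
`m ≥ 1` such that each arithmetic-progression restriction `n ↦ f (n·m + i)` either grows
exponentially or is eventually polynomial. -/
theorem binomialMultisum_growth_dichotomy (f : ℕ → ℕ) (hf : IsBinomialMultisum f) :
    ∃ m : ℕ, 1 ≤ m ∧ ∀ i < m,
      (∃ c₁ c₂ : ℝ, 0 < c₁ ∧ 0 < c₂ ∧ ∃ N : ℕ, ∀ n ≥ N,
          Real.exp (c₁ * n) ≤ (f (n * m + i) : ℝ) ∧
          (f (n * m + i) : ℝ) ≤ Real.exp (c₂ * n)) ∨
      (∃ (N : ℕ) (q : Polynomial ℚ), ∀ n ≥ N, (f (n * m + i) : ℚ) = q.eval (n : ℚ)) := by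
  obtain ⟨r, d, α, β, a, b, hfin, hsum⟩ := hf.exists_binomProd
  obtain ⟨K, hK⟩ := exists_two_pow_bound (fun _ => rfl) hfin
  obtain ⟨m, hm, hdich⟩ := fiberSum_binomProd_dichotomy hfin
  simp only [← hsum] at hK hdich
  refine ⟨m, hm, fun i hi => ?_⟩
  have hlog : 0 < Real.log 2 := Real.log_pos one_lt_two
  have hexp : ∀ k : ℕ, Real.exp (Real.log 2 * k) = 2 ^ k := fun k => by
    rw [Real.exp_mul, Real.exp_log two_pos, Real.rpow_natCast]
  rcases hdich i with ⟨n₀, hn₀⟩ | ⟨q, hq⟩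
  · left
    let L : ℕ := K * (2 * m + 1) + 1
    refine ⟨Real.log 2 / 2, Real.log 2 * L, by positivity, by positivity, 2 * n₀ + 1,
      fun n hn => ⟨?_, ?_⟩⟩
    · have h1 : (2 : ℝ) ^ (n - n₀) ≤ f (n * m + i) := by exact_mod_cast hn₀ n (by omega)
      refine le_trans ?_ h1
      rw [← hexp, Real.exp_le_exp]
      have h2 : (n : ℝ) ≤ 2 * (n - n₀ : ℕ) := by exact_mod_cast (by omega : n ≤ 2 * (n - n₀))
      nlinarith
    · have h1 : f (n * m + i) ≤ 2 ^ (L * n) := by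
        refine (hK _).trans (Nat.pow_le_pow_right two_pos ?_)
        have h2 : n * m + i + 1 ≤ (2 * m + 1) * n := by nlinarith
        calc K * (n * m + i + 1) ≤ K * ((2 * m + 1) * n) := Nat.mul_le_mul_left K h2
          _ ≤ L * n := by simp only [L]; nlinarith
      calc (f (n * m + i) : ℝ) ≤ 2 ^ (L * n) := by exact_mod_cast h1
        _ = Real.exp (Real.log 2 * L * n) := by rw [← hexp]; push_cast; ring_nf
  · right
    obtain ⟨N, hN⟩ := Filter.eventually_atTop.1 hq
    exact ⟨N, q, hN⟩
end
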